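/- arXiv:1801.00111 — 5 statements merged into one kernel-verified Lean document; each statement's English description precedes it below -/
import Mathlib

section
/- Let T be a tree on vertex set V. Define the square matrix B, indexed by V, by B_{uv} = μ_T(u,v)/m(T) for all u,v ∈ V (so B_{uv} ≠ 0 for u ≠ v exactly when T contains a u_M v alternating path for some maximum matching M of T). Then B is the generalized inverse A* of the adjacency matrix A of T. -/
/-! Basic definitions: matchings of a simple graph (as finite sets of edges),
maximum matchings, the number `m(T)` of maximum matchings, alternating paths,
the quantity `μ_T(u,v)`, and generalized inverses of real symmetric matrices. -/

variable {V : Type*}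

/-- `M` is a matching of `G`: a finite set of edges of `G` that are pairwise
vertex-disjoint. -/
def IsMatching (G : SimpleGraph V) (M : Finset (Sym2 V)) : Prop :=
  (∀ e ∈ M, e ∈ G.edgeSet) ∧
    ∀ e ∈ M, ∀ f ∈ M, e ≠ f → ∀ v : V, ¬(v ∈ e ∧ v ∈ f)

/-- `M` is a maximum matching of `G`: a matching of maximum cardinality. -/
def IsMaximumMatching (G : SimpleGraph V) (M : Finset (Sym2 V)) : Prop :=
  IsMatching G M ∧ ∀ M' : Finset (Sym2 V), IsMatching G M' → M'.card ≤ M.card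

/-- `m(G)`: the number of maximum matchings of `G`. -/
noncomputable def numMaxMatchings (G : SimpleGraph V) : ℕ :=
  {M : Finset (Sym2 V) | IsMaximumMatching G M}.ncard

/-- The matching `M` covers the vertex `v`. -/
def Covers (M : Finset (Sym2 V)) (v : V) : Prop := ∃ e ∈ M, v ∈ e

/-- A vertex `u` is saturated in `G` if every maximum matching of `G` covers it. -/
def Saturated (G : SimpleGraph V) (u : V) : Prop :=
  ∀ M : Finset (Sym2 V), IsMaximumMatching G M → Covers M u

/-- `p` is a `u_M v` alternating path: a path whose edges belong alternately to `M`
and not to `M`, with both the first and the last edge in `M` (equivalently, the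
`i`-th edge lies in `M` iff `i` is even, and the length is odd). -/
def IsAltPath (G : SimpleGraph V) (M : Finset (Sym2 V)) {u v : V} (p : G.Walk u v) : Prop :=
  p.IsPath ∧ Odd p.length ∧
    ∀ (i : ℕ) (h : i < p.edges.length), (p.edges.get ⟨i, h⟩ ∈ M ↔ Even i)

/-- There exists a `u_M v` alternating path in `G`. -/
def HasAltPath (G : SimpleGraph V) (M : Finset (Sym2 V)) (u v : V) : Prop :=
  ∃ p : G.Walk u v, IsAltPath G M p

/-- `μ_G(u,v)`: the sign `σ(u,v)` (which is `+1` if `dist(u,v) ≡ 1 (mod 4)` and `-1`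
if `dist(u,v) ≡ 3 (mod 4)`) times the number of maximum matchings `M` of `G` admitting
a `u_M v` alternating path; it is `0` when no such maximum matching exists. -/
noncomputable def muT (G : SimpleGraph V) (u v : V) : ℤ :=
  (if G.dist u v % 4 = 1 then 1 else -1) *
    ({M : Finset (Sym2 V) | IsMaximumMatching G M ∧ HasAltPath G M u v}.ncard : ℤ)

/-- `B` is the generalized inverse of the real symmetric matrix `A`: the (unique)
symmetric matrix `B` with `ABA = A`, `BAB = B` and `AB = BA`. -/
def IsGenInverse {n : Type*} [Fintype n] (A B : Matrix n n ℝ) : Prop :=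
  B.IsSymm ∧ A * B * A = A ∧ B * A * B = B ∧ A * B = B * A

namespace TB

lemma genInv_of {n : Type*} [Fintype n] [DecidableEq n] (A B Q C : Matrix n n ℝ)
    (hA : A.transpose = A) (hB : B.transpose = B)
    (h1 : A * B = 1 - Q.transpose) (h2 : A * Q = 0) (h3 : A * C = B) : IsGenInverse A B := by
  have h1' : B * A = 1 - Q := by
    have := congrArg Matrix.transpose h1
    simpa [Matrix.transpose_mul, hA, hB] using this
  have h2' : Q.transpose * A = 0 := by
    have := congrArg Matrix.transpose h2
    simpa [Matrix.transpose_mul, hA] using this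
  have h4 : A * B * B = B := by
    rw [h1, sub_mul, one_mul, sub_eq_self, ← h3, ← mul_assoc, h2', zero_mul]
  have h5 : B * (B * A) = B := by
    have := congrArg Matrix.transpose h4
    simpa [Matrix.transpose_mul, hA, hB] using this
  have h6 : A * B = B * A := by
    calc A * B = A * (B * (B * A)) := by rw [h5]
      _ = (A * B * B) * A := by simp only [mul_assoc]
      _ = B * A := by rw [h4]
  refine ⟨hB, ?_, ?_, h6⟩
  · rw [mul_assoc, h1', mul_sub, h2, mul_one, sub_zero]
  · rw [← h6, h4]

set_option linter.unusedSectionVars false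

section
variable {V : Type*} [DecidableEq V]

/-- Signed weight of an edge list. -/
def F (M : Finset (Sym2 V)) (a b : ℝ) : List (Sym2 V) → ℝ
  | [] => a
  | [e] => if e ∈ M then b else 0
  | e :: _ :: l => if e ∈ M then - F M a b l else 0

/-- Every other entry of a list. -/
def par {α : Type*} : Bool → List α → List α
  | _, [] => []
  | true, e :: l => e :: par false l
  | false, _ :: l => par true l

lemma F_E_append (M : Finset (Sym2 V)) (a : ℝ) (f : Sym2 V) : ∀ l : List (Sym2 V),
    F M a 0 (l ++ [f]) = - a * F M 0 1 l
  | [] => by simp [F]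
  | [e] => by by_cases h : e ∈ M <;> simp [F, h]
  | e :: g :: l => by
      have := F_E_append M a f l
      by_cases h : e ∈ M <;> simp [F, h, this]

lemma F_B_append (M : Finset (Sym2 V)) (f g : Sym2 V) : ∀ l : List (Sym2 V),
    F M 0 1 (l ++ [f, g]) = if g ∈ M then - F M 0 1 l else 0
  | [] => by simp [F]
  | [e] => by by_cases h : e ∈ M <;> by_cases h' : g ∈ M <;> simp [F, h, h']
  | e :: k :: l => by
      have := F_B_append M f g l
      by_cases h : e ∈ M <;> by_cases h' : g ∈ M <;> simp_all [F]

lemma F_B_reverse (M : Finset (Sym2 V)) : ∀ l : List (Sym2 V),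
    F M 0 1 l.reverse = F M 0 1 l
  | [] => by simp
  | [e] => by simp
  | e :: k :: l => by
      have := F_B_reverse M l
      simp only [List.reverse_cons, List.append_assoc, List.singleton_append]
      simp [F_B_append, this, F]

lemma F_B_closed (M : Finset (Sym2 V)) : ∀ l : List (Sym2 V),
    F M 0 1 l = if Odd l.length ∧ ∀ e ∈ par true l, e ∈ M then (-1 : ℝ) ^ (l.length / 2) else 0
  | [] => by simp [F]
  | [e] => by simp [F, par]
  | e :: k :: l => by
      have := F_B_closed M l
      have h2 : (l.length + 1 + 1) / 2 = l.length / 2 + 1 := by omega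
      by_cases h : e ∈ M
      · simp [F, this, par, h, parity_simps, h2, pow_succ]
        split_ifs <;> simp
      · simp [F, par, h]

lemma F_E_closed (M : Finset (Sym2 V)) (a : ℝ) : ∀ l : List (Sym2 V),
    F M a 0 l = if Even l.length ∧ ∀ e ∈ par true l, e ∈ M then a * (-1 : ℝ) ^ (l.length / 2) else 0
  | [] => by simp [F, par]
  | [e] => by simp [F, par]
  | e :: k :: l => by
      have := F_E_closed M a l
      have h2 : (l.length + 1 + 1) / 2 = l.length / 2 + 1 := by omega
      by_cases h : e ∈ M
      · simp [F, this, par, h, parity_simps, h2, pow_succ]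
        split_ifs <;> simp
      · simp [F, par, h]

open Classical in
/-- Indicator that `v` is missed by `M`. -/
noncomputable def miss (M : Finset (Sym2 V)) (v : V) : ℝ := if Covers M v then 0 else 1

lemma match_unique {G : SimpleGraph V} {M : Finset (Sym2 V)} (hM : IsMatching G M) {u v w : V}
    (h1 : s(u, v) ∈ M) (h2 : s(u, w) ∈ M) : v = w := by
  by_contra h
  exact hM.2 _ h1 _ h2 (by rw [ne_eq, Sym2.eq_iff]; grind) u (by simp)

lemma match_edge {G : SimpleGraph V} {M : Finset (Sym2 V)} (hM : IsMatching G M) {e f : Sym2 V}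
    {v : V} (h1 : e ∈ M) (h2 : f ∈ M) (hv : v ∈ e) (hv' : v ∈ f) : e = f := by
  by_contra h
  exact hM.2 _ h1 _ h2 h v ⟨hv, hv'⟩

lemma miss_sum [Fintype V] {G : SimpleGraph V} {M : Finset (Sym2 V)} (hM : IsMatching G M) (u : V) :
    ∑ v, (if s(u, v) ∈ M then (1 : ℝ) else 0) = 1 - miss M u := by
  unfold miss
  split_ifs with h
  · obtain ⟨e, he, hu⟩ := h
    obtain ⟨w, rfl⟩ := Sym2.mem_iff_exists.1 hu
    rw [Finset.sum_eq_single w]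
    · simp [he]
    · intro v _ hv
      rw [if_neg]
      exact fun h => hv (match_unique hM h he)
    · simp
  · rw [Finset.sum_eq_zero]
    · simp
    · intro v _
      rw [if_neg]
      exact fun h' => h ⟨_, h', by simp⟩

/-- The unique path. -/
noncomputable def tp {G : SimpleGraph V} (hT : G.IsTree) (u w : V) : G.Walk u w :=
  (hT.existsUnique_path u w).choose

lemma tp_isPath {G : SimpleGraph V} (hT : G.IsTree) (u w : V) : (tp hT u w).IsPath :=
  (hT.existsUnique_path u w).choose_spec.1

lemma tp_eq {G : SimpleGraph V} (hT : G.IsTree) {u w : V} {p : G.Walk u w} (hp : p.IsPath) :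
    tp hT u w = p :=
  ((hT.existsUnique_path u w).choose_spec.2 p hp).symm

lemma tp_self {G : SimpleGraph V} (hT : G.IsTree) (u : V) : tp hT u u = .nil :=
  tp_eq hT (by simp)

lemma tp_reverse {G : SimpleGraph V} (hT : G.IsTree) (u w : V) :
    tp hT u w = (tp hT w u).reverse :=
  tp_eq hT (tp_isPath hT w u).reverse

lemma tp_adj {G : SimpleGraph V} (hT : G.IsTree) {u w : V} (h : G.Adj u w) :
    tp hT u w = .cons h .nil :=
  tp_eq hT (by simp [h.ne])

lemma tp_back {G : SimpleGraph V} (hT : G.IsTree) {u v0 v w : V} (h : G.Adj u v0)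
    (q : G.Walk v0 w) (hq : tp hT u w = .cons h q) (hv : G.Adj u v) (hne : v ≠ v0) :
    tp hT v w = .cons hv.symm (.cons h q) := by
  apply tp_eq
  have h1 := tp_isPath hT u w
  rw [hq] at h1
  rw [hT.isAcyclic.isPath_iff_isChain] at h1 ⊢
  simp only [SimpleGraph.Walk.edges_cons] at h1 ⊢
  rw [List.isChain_cons_cons]
  refine ⟨?_, h1⟩
  simp only [ne_eq, Sym2.eq_iff]
  have := hv.ne
  grind

lemma key [Fintype V] {G : SimpleGraph V} [DecidableRel G.Adj] (hT : G.IsTree)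
    {M : Finset (Sym2 V)} (hM : IsMatching G M) (a b : ℝ)
    {u v0 w : V} (h : G.Adj u v0)
    (q : G.Walk v0 w) (hq : tp hT u w = .cons h q)
    (hF : F M a b q.edges ≠ 0 → s(u, v0) ∉ M) :
    ∑ v, G.adjMatrix ℝ u v * F M a b (tp hT v w).edges = miss M u * F M a b q.edges := by
  have hq0 : tp hT v0 w = q := by
    apply tp_eq
    have h1 := tp_isPath hT u w
    rw [hq] at h1
    exact h1.of_cons
  have e1 : ∀ v, G.adjMatrix ℝ u v * F M a b (tp hT v w).edges =
      (if v = v0 then F M a b q.edges else 0) -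
        (if s(u, v) ∈ M then (1 : ℝ) else 0) * F M a b q.edges := by
    intro v
    by_cases hv0 : v = v0
    · subst hv0
      rw [hq0]
      by_cases hz : F M a b q.edges = 0
      · simp [hz]
      · simp [hF hz, h]
    by_cases hv : G.Adj u v
    · rw [tp_back hT h q hq hv hv0]
      simp [hv, F, hv0, Sym2.eq_swap (a := v) (b := u)]
      split_ifs <;> simp
    · have : s(u, v) ∉ M := fun hh => hv (by simpa using hM.1 _ hh)
      simp [hv, hv0, this]
  rw [Finset.sum_congr rfl fun v _ => e1 v, Finset.sum_sub_distrib, ← Finset.sum_mul,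
    miss_sum hM]
  simp
  ring

/-- Matrix of alternating paths. -/
noncomputable def BM {G : SimpleGraph V} (hT : G.IsTree) (M : Finset (Sym2 V)) : Matrix V V ℝ :=
  Matrix.of fun u w => F M 0 1 (tp hT u w).edges

/-- Matrix of even alternating paths. -/
noncomputable def EM {G : SimpleGraph V} (hT : G.IsTree) (M : Finset (Sym2 V)) : Matrix V V ℝ :=
  Matrix.of fun u w => F M (miss M w) 0 (tp hT u w).edges

lemma BM_symm {G : SimpleGraph V} (hT : G.IsTree) (M : Finset (Sym2 V)) :
    (BM hT M).transpose = BM hT M := by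
  ext u w
  simp only [BM, Matrix.transpose_apply, Matrix.of_apply]
  rw [tp_reverse, SimpleGraph.Walk.edges_reverse, F_B_reverse]

lemma miss_mul_edge {M : Finset (Sym2 V)} {u v : V} (h : miss M u ≠ 0) : s(u, v) ∉ M := by
  intro hh
  exact h (by rw [miss, if_pos ⟨_, hh, by simp⟩])

lemma path_next {G : SimpleGraph V} (hT : G.IsTree) {M : Finset (Sym2 V)} (hM : IsMatching G M)
    {u v0 w z : V} (h : G.Adj u v0) (h' : G.Adj v0 z)
    (q : G.Walk z w) (hq : tp hT u w = .cons h (.cons h' q)) (hz : s(v0, z) ∈ M) :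
    s(u, v0) ∉ M := by
  intro hh
  have h1 := tp_isPath hT u w
  rw [hq] at h1
  have : u = z := match_unique hM (by rwa [Sym2.eq_swap]) hz
  subst this
  simp at h1

lemma A_BM [Fintype V] {G : SimpleGraph V} [DecidableRel G.Adj] (hT : G.IsTree)
    {M : Finset (Sym2 V)} (hM : IsMatching G M) :
    G.adjMatrix ℝ * BM hT M = 1 - (EM hT M).transpose := by
  ext u w
  simp only [Matrix.mul_apply, BM, EM, Matrix.of_apply, Matrix.sub_apply, Matrix.transpose_apply]
  by_cases huw : u = w
  · subst huw
    rw [tp_self]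
    simp only [Matrix.one_apply_eq, SimpleGraph.Walk.edges_nil, F]
    rw [← miss_sum hM u]
    refine Finset.sum_congr rfl fun v _ => ?_
    by_cases hv : G.Adj u v
    · rw [tp_adj hT hv.symm]
      simp [hv, F, Sym2.eq_swap (a := v) (b := u)]
    · have : s(u, v) ∉ M := fun hh => hv (by simpa using hM.1 _ hh)
      simp [hv, this]
  · rw [Matrix.one_apply_ne huw]
    rcases hq : tp hT u w with _ | ⟨h, q⟩
    · exact absurd rfl huw
    · rw [key hT hM 0 1 h q hq, tp_reverse hT w u, hq, SimpleGraph.Walk.edges_reverse,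
        SimpleGraph.Walk.edges_cons, List.reverse_cons, F_E_append, F_B_reverse]
      · ring
      · intro hF
        rcases q with _ | ⟨h', q⟩
        · simp [F] at hF
        · apply path_next hT hM h h' q hq
          by_contra hn
          rcases q with _ | ⟨h'', q⟩ <;> simp [F, hn] at hF

lemma A_EM_self [Fintype V] {G : SimpleGraph V} [DecidableRel G.Adj] (hT : G.IsTree)
    {M : Finset (Sym2 V)} (u : V) :
    (G.adjMatrix ℝ * EM hT M) u u = 0 := by
  simp only [Matrix.mul_apply, EM, Matrix.of_apply]
  refine Finset.sum_eq_zero fun v _ => ?_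
  by_cases hv : G.Adj u v
  · rw [tp_adj hT hv.symm]
    simp [F]
  · simp [hv]

lemma A_EM [Fintype V] {G : SimpleGraph V} [DecidableRel G.Adj] (hT : G.IsTree)
    {M : Finset (Sym2 V)} (hM : IsMatching G M) {u v0 w : V} (h : G.Adj u v0)
    (q : G.Walk v0 w) (hq : tp hT u w = .cons h q) :
    (G.adjMatrix ℝ * EM hT M) u w = miss M u * F M (miss M w) 0 q.edges := by
  simp only [Matrix.mul_apply, EM, Matrix.of_apply]
  rw [key hT hM _ _ h q hq]
  intro hF
  rcases q with _ | ⟨h', q⟩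
  · simp [F] at hF
    rw [Sym2.eq_swap]
    exact miss_mul_edge hF
  · apply path_next hT hM h h' q hq
    by_contra hn
    rcases q with _ | ⟨h'', q⟩ <;> simp [F, hn] at hF
lemma par_subset {α : Type*} : ∀ (b : Bool) (l : List α) (e : α), e ∈ par b l → e ∈ l
  | _, [], _, h => by simp [par] at h
  | true, a :: l, e, h => by
      simp only [par, List.mem_cons] at h
      rcases h with h | h
      · simp [h]
      · exact List.mem_cons_of_mem _ (par_subset false l e h)
  | false, a :: l, e, h => List.mem_cons_of_mem _ (par_subset true l e h)

lemma par_disj {α : Type*} : ∀ (b : Bool) (l : List α) (_ : l.Nodup) (e : α),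
    e ∈ par b l → e ∉ par (!b) l
  | _, [], _, _, h => by simp [par] at h
  | true, a :: l, hl, e, h => by
      simp only [par, List.mem_cons, Bool.not_true] at h ⊢
      rw [List.nodup_cons] at hl
      rcases h with h | h
      · subst h
        exact fun h => hl.1 (par_subset _ _ _ h)
      · exact par_disj false l hl.2 e h
  | false, a :: l, hl, e, h => by
      simp only [par, List.mem_cons, Bool.not_false] at h ⊢
      rw [List.nodup_cons] at hl
      rintro (h' | h')
      · subst h'
        exact hl.1 (par_subset _ _ _ h)
      · exact par_disj true l hl.2 e h h'

lemma par_nodup {α : Type*} : ∀ (b : Bool) (l : List α) (_ : l.Nodup), (par b l).Nodup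
  | _, [], _ => by simp [par]
  | true, a :: l, hl => by
      rw [List.nodup_cons] at hl
      simp only [par, List.nodup_cons]
      exact ⟨fun h => hl.1 (par_subset _ _ _ h), par_nodup false l hl.2⟩
  | false, a :: l, hl => by
      rw [List.nodup_cons] at hl
      exact par_nodup true l hl.2

lemma par_length {α : Type*} : ∀ (l : List α),
    (par true l).length = (par false l).length + l.length % 2
  | [] => by simp [par]
  | [a] => by simp [par]
  | a :: b :: l => by
      have := par_length l
      simp only [par, List.length_cons]
      omega

lemma par_get {α : Type*} : ∀ (l : List α) (i : ℕ) (h : i < l.length),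
    l[i] ∈ par (if Even i then true else !true) l
  | [], i, h => by simp at h
  | a :: l, 0, h => by simp [par]
  | a :: l, i + 1, h => by
      have ih := par_get l i (by simpa using h)
      by_cases hE : Even i
      · simpa [par, hE, parity_simps] using ih
      · rw [if_neg hE] at ih
        rw [if_pos (by simpa [parity_simps] using hE)]
        exact List.mem_cons_of_mem _ ih

lemma par_cov {G : SimpleGraph V} : ∀ {x u : V} (p : G.Walk x u) (b : Bool) (v : V),
    v ∈ p.support → (∃ e ∈ par b p.edges, v ∈ e) ∨ (v = x ∧ b = false) ∨
      (v = u ∧ (Even p.length ↔ b = true))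
  | _, _, .nil, b, v, hv => by
      simp at hv
      subst hv
      cases b <;> simp
  | x, u, .cons (v := y) h q, b, v, hv => by
      have ih := par_cov q (!b) v
      rw [SimpleGraph.Walk.support_cons, List.mem_cons] at hv
      cases b
      · rcases hv with rfl | hv
        · simp
        · rcases ih hv with ih | ih | ih
          · left; simpa [par] using ih
          · simp at ih
          · right; right
            refine ⟨ih.1, ?_⟩
            simpa [parity_simps] using ih.2
      · rcases hv with rfl | hv
        · left; simp [par]
        · rcases ih hv with ih | ih | ih
          · left; simp only [SimpleGraph.Walk.edges_cons, par, List.mem_cons]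
            obtain ⟨e, he, hv⟩ := ih
            exact ⟨e, Or.inr he, hv⟩
          · left; simp [par, ih.1]
          · right; right
            refine ⟨ih.1, ?_⟩
            simpa [parity_simps] using ih.2

lemma mem_supp {G : SimpleGraph V} {x u : V} (p : G.Walk x u) (b : Bool) {e : Sym2 V} {v : V}
    (he : e ∈ par b p.edges) (hv : v ∈ e) : v ∈ p.support := by
  obtain ⟨w, rfl⟩ := Sym2.mem_iff_exists.1 hv
  exact p.fst_mem_support_of_mem_edges (par_subset _ _ _ he)

lemma par_start {G : SimpleGraph V} {x u : V} (p : G.Walk x u) (hp : p.IsPath) (e : Sym2 V)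
    (he : e ∈ par false p.edges) : x ∉ e := by
  intro hx
  cases p with
  | nil => simp [par] at he
  | cons h q =>
    rw [SimpleGraph.Walk.cons_isPath_iff] at hp
    exact hp.2 (mem_supp q true he hx)

lemma par_end {G : SimpleGraph V} : ∀ {x u : V} (p : G.Walk x u) (_ : p.IsPath) (b : Bool)
    (_ : Even p.length ↔ b = true) (e : Sym2 V) (_ : e ∈ par b p.edges), u ∉ e
  | _, _, .nil, _, b, _, e, he => by simp [par] at he
  | x, u, .cons (v := y) h q, hp, b, hb, e, he => by
      intro hu
      rw [SimpleGraph.Walk.cons_isPath_iff] at hp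
      have ih := par_end q hp.1 (!b) (by cases b <;> simpa [parity_simps] using hb) e
      cases b
      · exact ih (by simpa [par] using he) hu
      · simp only [SimpleGraph.Walk.edges_cons, par, List.mem_cons] at he
        rcases he with rfl | he
        · rw [Sym2.mem_iff] at hu
          rcases hu with rfl | rfl
          · exact hp.2 q.end_mem_support
          · have : q = .nil := SimpleGraph.Walk.nil_iff_eq_nil.1 (SimpleGraph.Walk.isPath_iff_nil.1 hp.1)
            subst this
            simp at hb
        · exact ih (by simpa using he) hu

lemma par_match {G : SimpleGraph V} : ∀ {x u : V} (p : G.Walk x u) (_ : p.IsPath) (b : Bool)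
    (e f : Sym2 V) (_ : e ∈ par b p.edges) (_ : f ∈ par b p.edges) (v : V) (_ : v ∈ e) (_ : v ∈ f),
    e = f
  | _, _, .nil, _, b, e, f, he, hf, v, hv, hv' => by simp [par] at he
  | x, u, .cons (v := y) h q, hp, b, e, f, he, hf, v, hv, hv' => by
      rw [SimpleGraph.Walk.cons_isPath_iff] at hp
      have ih := par_match q hp.1 (!b) e f
      have key : ∀ g ∈ par false q.edges, v ∈ g → v ∉ s(x, y) := by
        intro g hg hvg hvx
        rw [Sym2.mem_iff] at hvx
        rcases hvx with rfl | rfl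
        · exact hp.2 (mem_supp q _ hg hvg)
        · exact par_start q hp.1 g hg hvg
      cases b
      · exact ih he hf v hv hv'
      · simp only [SimpleGraph.Walk.edges_cons, par, List.mem_cons] at he hf
        rcases he with rfl | he <;> rcases hf with rfl | hf
        · rfl
        · exact (key _ hf hv' hv).elim
        · exact (key _ he hv hv').elim
        · exact ih he hf v hv hv'

/-- swap -/
def swp (M : Finset (Sym2 V)) (b : Bool) (l : List (Sym2 V)) : Finset (Sym2 V) :=
  (M \ (par b l).toFinset) ∪ (par (!b) l).toFinset

lemma swp_matching {G : SimpleGraph V} {x u : V} (p : G.Walk x u) (hp : p.IsPath)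
    {M : Finset (Sym2 V)} (hM : IsMatching G M) (b : Bool)
    (hcov : ∀ v ∈ p.support, ∀ e ∈ M, v ∈ e → e ∈ par b p.edges) :
    IsMatching G (swp M b p.edges) := by
  refine ⟨?_, ?_⟩
  · intro e he
    simp only [swp, Finset.mem_union, Finset.mem_sdiff, List.mem_toFinset] at he
    rcases he with he | he
    · exact hM.1 _ he.1
    · exact p.edges_subset_edgeSet (par_subset _ _ _ he)
  · intro e he f hf hef v hv
    simp only [swp, Finset.mem_union, Finset.mem_sdiff, List.mem_toFinset] at he hf
    rcases he with he | he <;> rcases hf with hf | hf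
    · exact hM.2 e he.1 f hf.1 hef v hv
    · exact he.2 (hcov v (mem_supp p _ hf hv.2) e he.1 hv.1)
    · exact hf.2 (hcov v (mem_supp p _ he hv.1) f hf.1 hv.2)
    · exact hef (par_match p hp _ e f he hf v hv.1 hv.2)

lemma swp_swp (M : Finset (Sym2 V)) (b : Bool) (l : List (Sym2 V)) (_hl : l.Nodup)
    (h1 : ∀ e ∈ par b l, e ∈ M) (h2 : ∀ e ∈ par (!b) l, e ∉ M) :
    swp (swp M b l) (!b) l = M := by
  ext e
  have := h1 e
  have := h2 e
  simp only [swp, Finset.mem_union, Finset.mem_sdiff, List.mem_toFinset, Bool.not_not]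
  tauto

lemma swp_card (M : Finset (Sym2 V)) (b : Bool) (l : List (Sym2 V)) (hl : l.Nodup)
    (h1 : ∀ e ∈ par b l, e ∈ M) (h2 : ∀ e ∈ par (!b) l, e ∉ M) :
    (swp M b l).card + (par b l).length = M.card + (par (!b) l).length := by
  rw [swp, Finset.card_union_of_disjoint, List.toFinset_card_of_nodup (par_nodup _ _ hl)]
  · have := Finset.card_sdiff_add_card_eq_card (s := (par b l).toFinset) (t := M)
      (fun e he => h1 e (by simpa using he))
    rw [List.toFinset_card_of_nodup (par_nodup _ _ hl)] at this
    omega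
  · rw [Finset.disjoint_left]
    intro e he he'
    simp only [Finset.mem_sdiff, List.mem_toFinset] at he he'
    exact h2 e he' he.1

/-- alternating condition -/
def AltC {G : SimpleGraph V} {x u : V} (p : G.Walk x u) (M : Finset (Sym2 V)) : Prop :=
  IsMatching G M ∧ ∀ e ∈ par true p.edges, e ∈ M

/-- augmenting condition -/
def AugC {G : SimpleGraph V} {x u : V} (p : G.Walk x u) (M : Finset (Sym2 V)) : Prop :=
  IsMatching G M ∧ (∀ e ∈ par false p.edges, e ∈ M) ∧ ¬ Covers M x ∧ ¬ Covers M u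

lemma AltC.cov {G : SimpleGraph V} {x u : V} {p : G.Walk x u} {M : Finset (Sym2 V)}
    (h : AltC p M) (ho : Odd p.length) :
    ∀ v ∈ p.support, ∀ e ∈ M, v ∈ e → e ∈ par true p.edges := by
  intro v hv e he hve
  rcases par_cov p true v hv with ⟨f, hf, hvf⟩ | h' | h'
  · rwa [match_edge h.1 he (h.2 f hf) hve hvf]
  · simp at h'
  · exact absurd ho (by simpa using h'.2)

lemma AugC.cov {G : SimpleGraph V} {x u : V} {p : G.Walk x u} {M : Finset (Sym2 V)}
    (h : AugC p M) :
    ∀ v ∈ p.support, ∀ e ∈ M, v ∈ e → e ∈ par false p.edges := by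
  intro v hv e he hve
  rcases par_cov p false v hv with ⟨f, hf, hvf⟩ | h' | h'
  · rwa [match_edge h.1 he (h.2.1 f hf) hve hvf]
  · exact absurd ⟨e, he, h'.1 ▸ hve⟩ h.2.2.1
  · exact absurd ⟨e, he, h'.1 ▸ hve⟩ h.2.2.2

lemma not_mem_of_cov {G : SimpleGraph V} {x u : V} {p : G.Walk x u} (hp : p.IsPath)
    {M : Finset (Sym2 V)} {b : Bool}
    (h : ∀ v ∈ p.support, ∀ e ∈ M, v ∈ e → e ∈ par b p.edges) : ∀ e ∈ par (!b) p.edges, e ∉ M := by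
  intro e he heM
  have hv : e.out.1 ∈ e := Sym2.out_fst_mem e
  have := par_disj _ _ hp.isTrail.edges_nodup _ (h _ (mem_supp p _ he hv) e heM hv)
  exact this he

lemma AltC.swp {G : SimpleGraph V} {x u : V} {p : G.Walk x u} (hp : p.IsPath)
    {M : Finset (Sym2 V)} (h : AltC p M) (ho : Odd p.length) :
    AugC p (swp M true p.edges) ∧ (TB.swp M true p.edges).card + 1 = M.card ∧
      TB.swp (TB.swp M true p.edges) false p.edges = M := by
  have hc := h.cov ho
  have hn := not_mem_of_cov hp hc
  have hl := hp.isTrail.edges_nodup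
  refine ⟨⟨swp_matching p hp h.1 true hc, ?_, ?_, ?_⟩, ?_, swp_swp M true _ hl h.2 hn⟩
  · intro e he
    simp [TB.swp, he]
  · rintro ⟨e, he, hx⟩
    simp only [TB.swp, Finset.mem_union, Finset.mem_sdiff, List.mem_toFinset] at he
    rcases he with he | he
    · exact he.2 (hc x p.start_mem_support e he.1 hx)
    · exact par_start p hp e he hx
  · rintro ⟨e, he, hx⟩
    simp only [TB.swp, Finset.mem_union, Finset.mem_sdiff, List.mem_toFinset] at he
    rcases he with he | he
    · exact he.2 (hc u p.end_mem_support e he.1 hx)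
    · exact par_end p hp false (by simpa using ho) e he hx
  · have h1 := swp_card M true _ hl h.2 hn
    have h2 := par_length p.edges
    rw [SimpleGraph.Walk.length_edges, Nat.odd_iff.1 ho] at h2
    simp only [Bool.not_true] at h1
    omega

lemma AugC.swp {G : SimpleGraph V} {x u : V} {p : G.Walk x u} (hp : p.IsPath)
    {M : Finset (Sym2 V)} (h : AugC p M) (ho : Odd p.length) :
    AltC p (swp M false p.edges) ∧ (TB.swp M false p.edges).card = M.card + 1 ∧
      TB.swp (TB.swp M false p.edges) true p.edges = M := by
  have hc := h.cov
  have hn := not_mem_of_cov hp hc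
  have hl := hp.isTrail.edges_nodup
  refine ⟨⟨swp_matching p hp h.1 false hc, ?_⟩, ?_, swp_swp M false _ hl h.2.1 hn⟩
  · intro e he
    simp [TB.swp, he]
  · have h1 := swp_card M false _ hl h.2.1 hn
    have h2 := par_length p.edges
    rw [SimpleGraph.Walk.length_edges, Nat.odd_iff.1 ho] at h2
    simp only [Bool.not_false] at h1
    omega

lemma isAlt_iff {G : SimpleGraph V} {x u : V} {p : G.Walk x u} (hp : p.IsPath)
    {M : Finset (Sym2 V)} (hM : IsMatching G M) :
    IsAltPath G M p ↔ Odd p.length ∧ ∀ e ∈ par true p.edges, e ∈ M := by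
  have hl := hp.isTrail.edges_nodup
  constructor
  · rintro ⟨-, ho, h⟩
    refine ⟨ho, fun e he => ?_⟩
    obtain ⟨i, hi, rfl⟩ := List.getElem_of_mem (par_subset _ _ _ he)
    refine (h i hi).2 ?_
    by_contra hn
    have := par_get p.edges i hi
    rw [if_neg hn] at this
    exact par_disj _ _ hl _ he this
  · rintro ⟨ho, h⟩
    have hn := not_mem_of_cov hp (AltC.cov ⟨hM, h⟩ ho)
    refine ⟨hp, ho, fun i hi => ?_⟩
    have := par_get p.edges i hi
    by_cases hE : Even i
    · rw [if_pos hE] at this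
      simpa [hE] using h _ this
    · rw [if_neg hE] at this
      simpa [hE] using hn _ this
open Classical in
lemma term_E [Fintype V] {G : SimpleGraph V} [DecidableRel G.Adj] (hT : G.IsTree)
    {M : Finset (Sym2 V)} (hM : IsMatching G M) (u w : V) :
    (G.adjMatrix ℝ * EM hT M) u w =
      if Odd (tp hT u w).length ∧ AugC (tp hT u w) M then (-1 : ℝ) ^ ((tp hT u w).length / 2)
      else 0 := by
  by_cases huw : u = w
  · subst huw
    rw [A_EM_self, tp_self]
    simp
  · rcases hq : tp hT u w with _ | ⟨h, q⟩
    · exact absurd rfl huw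
    · rw [A_EM hT hM h q hq, F_E_closed]
      simp only [SimpleGraph.Walk.length_cons, SimpleGraph.Walk.length_edges, AugC, hM,
        SimpleGraph.Walk.edges_cons, par, true_and, miss]
      by_cases ho : Even q.length
      · have h2 : (q.length + 1) / 2 = q.length / 2 := by
          obtain ⟨k, hk⟩ := ho
          omega
        rw [h2]
        by_cases c1 : Covers M u <;> by_cases c2 : Covers M w <;>
          simp [c1, c2, ho, parity_simps]
      · simp [ho, parity_simps]

open Classical in
lemma term_B {G : SimpleGraph V} (hT : G.IsTree)
    {M : Finset (Sym2 V)} (hM : IsMatching G M) (u w : V) :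
    BM hT M u w =
      if Odd (tp hT u w).length ∧ AltC (tp hT u w) M then (-1 : ℝ) ^ ((tp hT u w).length / 2)
      else 0 := by
  simp only [BM, Matrix.of_apply, F_B_closed, AltC, hM, true_and, SimpleGraph.Walk.length_edges]

lemma hasAlt_iff {G : SimpleGraph V} (hT : G.IsTree)
    {M : Finset (Sym2 V)} (hM : IsMatching G M) (u w : V) :
    HasAltPath G M u w ↔ Odd (tp hT u w).length ∧ AltC (tp hT u w) M := by
  rw [HasAltPath, AltC, and_iff_right hM, ← isAlt_iff (tp_isPath hT u w) hM]
  constructor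
  · rintro ⟨p, hp⟩
    rwa [tp_eq hT hp.1]
  · exact fun h => ⟨_, h⟩

lemma dist_eq {G : SimpleGraph V} (hT : G.IsTree) (u w : V) :
    G.dist u w = (tp hT u w).length := by
  obtain ⟨p, hp, hl⟩ := hT.connected.exists_path_of_dist u w
  rw [tp_eq hT hp, hl]

open Classical in
/-- Matchings of size `n` such that `n + d = k`. -/
noncomputable def MX [Fintype V] (G : SimpleGraph V) (d k : ℕ) : Finset (Finset (Sym2 V)) :=
  Finset.univ.filter fun M => IsMatching G M ∧ M.card + d = k

open Classical in
lemma sum_E [Fintype V] {G : SimpleGraph V} [DecidableRel G.Adj] (hT : G.IsTree) (k : ℕ) :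
    G.adjMatrix ℝ * ∑ M ∈ MX G 1 k, EM hT M = ∑ M ∈ MX G 0 k, BM hT M := by
  ext u w
  rw [Finset.mul_sum, Matrix.sum_apply, Matrix.sum_apply]
  have hm : ∀ d M, M ∈ MX G d k ↔ IsMatching G M ∧ M.card + d = k := by simp [MX]
  rw [Finset.sum_congr rfl fun M hM => term_E hT ((hm _ _).1 hM).1 u w,
    Finset.sum_congr rfl fun M hM => term_B hT ((hm _ _).1 hM).1 u w]
  rw [← Finset.sum_filter, ← Finset.sum_filter]
  have hp := tp_isPath hT u w
  refine Finset.sum_nbij' (fun M => swp M false (tp hT u w).edges)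
    (fun M => swp M true (tp hT u w).edges) ?_ ?_ ?_ ?_ ?_
  · intro M hM
    rw [Finset.mem_filter, hm] at hM
    obtain ⟨h1, h2, h3⟩ := hM.2.2.swp hp hM.2.1
    rw [Finset.mem_filter, hm]
    exact ⟨⟨h1.1, by omega⟩, hM.2.1, h1⟩
  · intro M hM
    rw [Finset.mem_filter, hm] at hM
    obtain ⟨h1, h2, h3⟩ := hM.2.2.swp hp hM.2.1
    rw [Finset.mem_filter, hm]
    exact ⟨⟨h1.1, by omega⟩, hM.2.1, h1⟩
  · intro M hM
    rw [Finset.mem_filter, hm] at hM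
    exact (hM.2.2.swp hp hM.2.1).2.2
  · intro M hM
    rw [Finset.mem_filter, hm] at hM
    exact (hM.2.2.swp hp hM.2.1).2.2
  · intros
    rfl

lemma E_zero [Fintype V] {G : SimpleGraph V} [DecidableRel G.Adj] (hT : G.IsTree)
    {M : Finset (Sym2 V)} (hM : IsMaximumMatching G M) :
    G.adjMatrix ℝ * EM hT M = 0 := by
  ext u w
  rw [term_E hT hM.1, if_neg]
  · rfl
  · rintro ⟨ho, h⟩
    obtain ⟨h1, h2, -⟩ := h.swp (tp_isPath hT u w) ho
    have := hM.2 _ h1.1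
    omega

lemma exists_nu [Fintype V] (G : SimpleGraph V) : ∃ k,
    (∀ M, M ∈ MX G 0 k ↔ IsMaximumMatching G M) ∧ (MX G 0 k).Nonempty := by
  classical
  obtain ⟨M0, hM0, hmax⟩ := Finset.exists_max_image
    (Finset.univ.filter fun M : Finset (Sym2 V) => IsMatching G M) Finset.card
    ⟨∅, by simp [IsMatching]⟩
  simp only [Finset.mem_filter, Finset.mem_univ, true_and] at hM0 hmax
  refine ⟨M0.card, fun M => ?_, M0, by simp [MX, hM0]⟩
  simp only [MX, Finset.mem_filter, Finset.mem_univ, true_and, add_zero, IsMaximumMatching]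
  constructor
  · rintro ⟨h, hc⟩
    exact ⟨h, fun M' h' => hc ▸ hmax M' h'⟩
  · rintro ⟨h, h'⟩
    exact ⟨h, le_antisymm (hmax M h) (h' M0 hM0)⟩

lemma sum_B [Fintype V] {G : SimpleGraph V} (hT : G.IsTree) (k : ℕ)
    (hk : ∀ M, M ∈ MX G 0 k ↔ IsMaximumMatching G M) (u w : V) :
    (∑ M ∈ MX G 0 k, BM hT M) u w = (muT G u w : ℝ) := by
  classical
  rw [Matrix.sum_apply, Finset.sum_congr rfl fun M hM => term_B hT ((hk _).1 hM).1 u w]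
  have hs : {M : Finset (Sym2 V) | IsMaximumMatching G M ∧ HasAltPath G M u w} =
      ((MX G 0 k).filter fun M => Odd (tp hT u w).length ∧ AltC (tp hT u w) M : Finset _) := by
    ext M
    simp only [Set.mem_setOf_eq, Finset.coe_filter, hk]
    exact and_congr_right fun h => hasAlt_iff hT h.1 u w
  rw [muT, hs, Set.ncard_coe_finset, ← Finset.sum_filter, Finset.sum_const, nsmul_eq_mul, dist_eq hT]
  by_cases ho : Odd (tp hT u w).length
  · push_cast
    rw [mul_comm]
    congr 1
    obtain ⟨m, hm⟩ := ho
    rw [hm, show (2 * m + 1) / 2 = m by omega]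
    rcases Nat.even_or_odd m with he | he
    · rw [he.neg_one_pow, if_pos]
      obtain ⟨r, hr⟩ := he
      omega
    · rw [he.neg_one_pow, if_neg]
      obtain ⟨r, hr⟩ := he
      omega
  · simp [ho]

end
end TB

/-- Let `T` be a tree on vertex set `V` (with at least two vertices), with
adjacency matrix `A`. The matrix `B` with entries `B_{uv} = μ_T(u,v)/m(T)` is the generalized
inverse of `A`. -/
theorem stmt0 {V : Type*} [Fintype V] [DecidableEq V] (G : SimpleGraph V)
    [DecidableRel G.Adj] (hT : G.IsTree) (hV : 2 ≤ Fintype.card V)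
    (B : Matrix V V ℝ)
    (hB : ∀ u v : V, B u v = (muT G u v : ℝ) / (numMaxMatchings G : ℝ)) :
    IsGenInverse (G.adjMatrix ℝ) B := by
  obtain ⟨k, hk, hne⟩ := TB.exists_nu G
  have hN : (numMaxMatchings G : ℝ) = ((TB.MX G 0 k).card : ℝ) := by
    rw [numMaxMatchings, ← Set.ncard_coe_finset]
    congr 2
    ext M
    simp [hk]
  have hc : ((TB.MX G 0 k).card : ℝ) ≠ 0 := by
    simpa using hne.ne_empty
  rw [hN] at hB
  set c : ℝ := ((TB.MX G 0 k).card : ℝ) with hcdef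
  have hB' : B = c⁻¹ • ∑ M ∈ TB.MX G 0 k, TB.BM hT M := by
    ext u w
    rw [hB, Matrix.smul_apply, TB.sum_B hT k hk, smul_eq_mul, div_eq_inv_mul]
  apply TB.genInv_of (G.adjMatrix ℝ) B (c⁻¹ • ∑ M ∈ TB.MX G 0 k, TB.EM hT M)
    (c⁻¹ • ∑ M ∈ TB.MX G 1 k, TB.EM hT M)
  · exact G.transpose_adjMatrix
  · rw [hB', Matrix.transpose_smul, Matrix.transpose_sum]
    simp only [TB.BM_symm]
  · rw [hB', Matrix.mul_smul, Finset.mul_sum,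
      Finset.sum_congr rfl fun M hM => TB.A_BM hT ((hk _).1 hM).1, Finset.sum_sub_distrib,
      Finset.sum_const, Matrix.transpose_smul, Matrix.transpose_sum, smul_sub, ← Nat.cast_smul_eq_nsmul ℝ,
      smul_smul, ← hcdef, inv_mul_cancel₀ hc, one_smul]
  · rw [Matrix.mul_smul, Finset.mul_sum,
      Finset.sum_congr rfl fun M hM => TB.E_zero hT ((hk _).1 hM)]
    simp
  · rw [Matrix.mul_smul, TB.sum_E, hB']
end

section
/- Let u be a saturated vertex of a tree T. Then for every vertex w of T: Σ_{v∈T(w)} μ_T(u,v) = m(T) if w = u, and Σ_{v∈T(w)} μ_T(u,v) = 0 if w ≠ u. -/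
/-! Basic definitions: matchings of a simple graph (as finite sets of edges),
maximum matchings, the number `m(T)` of maximum matchings, alternating paths,
the quantity `μ_T(u,v)`, and generalized inverses of real symmetric matrices. -/

variable {V : Type*}

/-- alternation of a list of edges -/
def AltL (M : Finset (Sym2 V)) (l : List (Sym2 V)) : Prop :=
  ∀ (i : ℕ) (h : i < l.length), (l.get ⟨i, h⟩ ∈ M ↔ Even i)

theorem altL_snoc (M : Finset (Sym2 V)) (l : List (Sym2 V)) (a : Sym2 V) :
    AltL M (l ++ [a]) ↔ AltL M l ∧ (a ∈ M ↔ Even l.length) := by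
  unfold AltL
  constructor
  · intro h
    refine ⟨fun i hi => ?_, ?_⟩
    · have := h i (by simp; omega)
      simpa [List.getElem_append, hi] using this
    · have := h l.length (by simp)
      simpa using this
  · rintro ⟨h1, h2⟩ i hi
    by_cases hl : i < l.length
    · simpa [List.getElem_append, hl] using h1 i hl
    · have : i = l.length := by simp at hi; omega
      subst this
      simpa using h2

theorem altL_cons_cons (M : Finset (Sym2 V)) (l : List (Sym2 V)) (a b : Sym2 V)
    (h : AltL M (a :: b :: l)) : a ∈ M ∧ b ∉ M ∧ AltL M l := by
  refine ⟨?_, ?_, ?_⟩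
  · simpa using h 0 (by simp)
  · simpa using h 1 (by simp)
  · intro i hi
    have := h (i + 2) (by simp; omega)
    simpa [Nat.even_add] using this

theorem ncard_partition {α β : Type*} [Finite β] (S : Set β) (s : Finset α) (B : α → Set β)
    (h1 : ∀ M, M ∈ S ↔ ∃ v ∈ s, M ∈ B v)
    (h2 : ∀ M, ∀ v ∈ s, ∀ v' ∈ s, M ∈ B v → M ∈ B v' → v = v') :
    S.ncard = ∑ v ∈ s, (B v).ncard := by
  classical
  have := Fintype.ofFinite β
  have e : ∀ T : Set β, T.ncard = T.toFinset.card := fun T => by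
    rw [Set.ncard_eq_toFinset_card']
  simp only [e]
  rw [← Finset.card_biUnion]
  · congr 1
    ext M
    simp [h1]
  · intro v hv v' hv' hne
    rw [Function.onFun, Finset.disjoint_left]
    intro M hM hM'
    simp at hM hM'
    exact hne (h2 M v hv v' hv' hM hM')

theorem hasAlt_iff {G : SimpleGraph V} (hT : G.IsTree) (M : Finset (Sym2 V)) {u v : V}
    (p : G.Walk u v) (hp : p.IsPath) :
    HasAltPath G M u v ↔ Odd p.length ∧ AltL M p.edges := by
  constructor
  · rintro ⟨q, hq, h⟩
    have := (hT.existsUnique_path u v).unique hp hq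
    subst this
    exact h
  · intro h
    exact ⟨p, hp, h⟩

theorem dist_eq_len {G : SimpleGraph V} (hT : G.IsTree) {u v : V}
    (p : G.Walk u v) (hp : p.IsPath) : G.dist u v = p.length := by
  obtain ⟨q, hq, h⟩ := (hT.connected u v).exists_path_of_dist
  rw [(hT.existsUnique_path u v).unique hp hq, h]

theorem switch {G : SimpleGraph V} [DecidableEq V] (M : Finset (Sym2 V))
    (hM : IsMaximumMatching G M) {w : V} (hw : ¬ Covers M w) (n : ℕ) :
    ∀ {u : V} (p : G.Walk u w), p.length = 2 * n → p.IsPath → AltL M p.edges →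
      ∃ M', IsMaximumMatching G M' ∧ ¬ Covers M' u ∧ ∀ e ∈ M, e ∉ p.edges → e ∈ M' := by
  induction n with
  | zero =>
    intro u p hl _ _
    have := SimpleGraph.Walk.eq_of_length_eq_zero (p := p) (by simpa using hl)
    subst this
    exact ⟨M, hM, hw, fun e he _ => he⟩
  | succ n ih =>
    intro u p hl hp ha
    match p, hl, hp, ha with
    | .cons (v := a) h1 (.cons (v := b) h2 r), hl, hp, ha =>
      simp only [SimpleGraph.Walk.length_cons] at hl
      simp only [SimpleGraph.Walk.edges_cons] at ha
      obtain ⟨hm1, hm2, har⟩ := altL_cons_cons _ _ _ _ ha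
      simp only [SimpleGraph.Walk.cons_isPath_iff, SimpleGraph.Walk.support_cons,
        List.mem_cons, not_or] at hp
      obtain ⟨⟨hr, har'⟩, hua, hur⟩ := hp
      obtain ⟨M', hM', hb, hsub⟩ := ih r (by omega) hr har
      have hne1 : s(u, a) ∉ r.edges := fun h => hur (r.fst_mem_support_of_mem_edges h)
      have hin : s(u, a) ∈ M' := hsub _ hm1 hne1
      have hub : u ≠ b := fun h => hur (h ▸ r.start_mem_support)
      have hab : s(a, b) ∉ M' := fun h => hb ⟨_, h, by simp⟩
      have key : ∀ e ∈ M', e ≠ s(u, a) → u ∉ e ∧ a ∉ e ∧ b ∉ e := by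
        intro e he hne
        refine ⟨fun h => ?_, fun h => ?_, fun h => hb ⟨e, he, h⟩⟩
        · exact hM'.1.2 e he _ hin hne u ⟨h, by simp⟩
        · exact hM'.1.2 e he _ hin hne a ⟨h, by simp⟩
      refine ⟨insert s(a, b) (M'.erase s(u, a)), ⟨⟨?_, ?_⟩, ?_⟩, ?_, ?_⟩
      · intro e he
        simp only [Finset.mem_insert, Finset.mem_erase] at he
        rcases he with rfl | he
        · exact h2
        · exact hM'.1.1 e he.2
      · intro e he f hf hne v hv
        simp only [Finset.mem_insert, Finset.mem_erase] at he hf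
        rcases he with rfl | he <;> rcases hf with rfl | hf
        · exact hne rfl
        · have := key f hf.2 hf.1
          simp only [Sym2.mem_iff] at hv
          rcases hv with ⟨rfl | rfl, h⟩
          · exact this.2.1 h
          · exact this.2.2 h
        · have := key e he.2 he.1
          simp only [Sym2.mem_iff] at hv
          rcases hv with ⟨h, rfl | rfl⟩
          · exact this.2.1 h
          · exact this.2.2 h
        · exact hM'.1.2 e he.2 f hf.2 hne v hv
      · intro N hN
        rw [Finset.card_insert_of_notMem (by simp [hab]), Finset.card_erase_add_one hin]
        exact hM'.2 N hN
      · rintro ⟨e, he, hue⟩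
        simp only [Finset.mem_insert, Finset.mem_erase] at he
        rcases he with rfl | he
        · simp only [Sym2.mem_iff] at hue
          rcases hue with h | h
          · exact hua h
          · exact hub h
        · exact (key e he.2 he.1).1 hue
      · intro e he hne
        simp only [SimpleGraph.Walk.edges_cons, List.mem_cons, not_or] at hne
        simp only [Finset.mem_insert, Finset.mem_erase]
        exact Or.inr ⟨hne.1, hsub e he hne.2.2⟩

theorem match_unique {G : SimpleGraph V} {M : Finset (Sym2 V)} (hM : IsMatching G M) {w v v' : V}
    (h : s(w, v) ∈ M) (h' : s(w, v') ∈ M) : v = v' := by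
  by_contra hne
  exact hM.2 _ h _ h' (fun h => hne (Sym2.congr_right.1 h)) w (by simp)

theorem covers_nbr {G : SimpleGraph V} {M : Finset (Sym2 V)} (hM : IsMatching G M) {w : V}
    (h : Covers M w) : ∃ v, G.Adj w v ∧ s(w, v) ∈ M := by
  obtain ⟨e, he, hw⟩ := h
  obtain ⟨v, rfl⟩ := Sym2.mem_iff_exists.1 hw
  exact ⟨v, hM.1 _ he, he⟩

theorem stmt4 {V : Type*} [Fintype V] [DecidableEq V] (G : SimpleGraph V)
    [DecidableRel G.Adj] (hT : G.IsTree) (hV : 2 ≤ Fintype.card V)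
    (u : V) (hu : Saturated G u) (w : V) :
    ∑ v ∈ G.neighborFinset w, muT G u v
      = if w = u then (numMaxMatchings G : ℤ) else 0 := by
  split_ifs with hwu
  · subst hwu
    have alt : ∀ v, G.Adj w v → ∀ M, (HasAltPath G M w v ↔ s(w, v) ∈ M) := by
      intro v hv M
      rw [hasAlt_iff hT M (.cons hv .nil) (by simp [hv.ne])]
      have := altL_snoc M [] s(w, v)
      simp only [List.nil_append] at this
      simp [this, AltL]
    have hd : ∀ v ∈ G.neighborFinset w, muT G w v =
        (({M | IsMaximumMatching G M ∧ HasAltPath G M w v}.ncard : ℕ) : ℤ) := by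
      intro v hv
      have hv : G.Adj w v := by simpa using hv
      simp [muT, SimpleGraph.dist_eq_one_iff_adj.2 hv]
    rw [Finset.sum_congr rfl hd, ← Nat.cast_sum, numMaxMatchings]
    congr 1
    symm
    apply ncard_partition
    · intro M
      constructor
      · intro hM
        obtain ⟨v, hv, h⟩ := covers_nbr hM.1 (hu M hM)
        exact ⟨v, by simpa using hv, hM, (alt v hv M).2 h⟩
      · rintro ⟨v, _, h⟩
        exact h.1
    · intro M v hv v' hv' h h'
      rw [SimpleGraph.mem_neighborFinset] at hv hv'
      exact match_unique h.1.1 ((alt v hv M).1 h.2) ((alt v' hv' M).1 h'.2)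
  · obtain ⟨q, hq, -⟩ := hT.existsUnique_path u w
    have hnil : ¬ q.Nil := fun h => hwu h.eq.symm
    obtain ⟨x, p, hxw, rfl⟩ : ∃ (x : V) (p : G.Walk u x) (h : G.Adj x w), q = p.concat h :=
      ⟨_, _, q.adj_penultimate hnil, (q.concat_dropLast (q.adj_penultimate hnil)).symm⟩
    obtain ⟨hp, hwp⟩ := (SimpleGraph.Walk.concat_isPath_iff hxw).1 hq
    have hx : x ∈ G.neighborFinset w := by simpa using hxw.symm
    have hpath : ∀ v (hv : G.Adj w v), v ≠ x → ((p.concat hxw).concat hv).IsPath := by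
      intro v hv hne
      refine hq.concat (fun hs => hne ?_) hv
      have := hT.isAcyclic.eq_penultimate_of_adj_end hq hv hs
      simpa using this
    rw [← Finset.add_sum_erase _ _ hx]
    by_cases hodd : Odd p.length
    · have hA : ∀ M, HasAltPath G M u x ↔ AltL M p.edges := by
        intro M; rw [hasAlt_iff hT M p hp]; simp [hodd]
      have hB : ∀ v, G.Adj w v → v ≠ x → ∀ M, (HasAltPath G M u v ↔
          (AltL M p.edges ∧ s(x, w) ∉ M) ∧ s(w, v) ∈ M) := by
        intro v hv hne M
        rw [hasAlt_iff hT M _ (hpath v hv hne)]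
        simp only [SimpleGraph.Walk.edges_concat, SimpleGraph.Walk.length_concat,
          List.concat_eq_append, altL_snoc, List.length_append, SimpleGraph.Walk.length_edges]
        have h1 : ¬ Even p.length := by simpa using hodd
        have h2 : Even (p.length + 1) := hodd.add_one
        have h3 : Odd (p.length + 1 + 1) := h2.add_one
        simp [h1, h2, h3]
      have key : {M | IsMaximumMatching G M ∧ HasAltPath G M u x}.ncard =
          ∑ v ∈ (G.neighborFinset w).erase x,
            {M | IsMaximumMatching G M ∧ HasAltPath G M u v}.ncard := by
        apply ncard_partition
        · intro M
          constructor
          · rintro ⟨hM, ha⟩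
            rw [hA] at ha
            have hxw' : s(x, w) ∉ M := by
              intro hin
              -- last edge of p
              have hn : ¬ p.Nil := by
                intro h
                rw [SimpleGraph.Walk.nil_iff_length_eq.1 h] at hodd
                simp at hodd
              obtain ⟨y, r, hyx, rfl⟩ : ∃ (y : V) (r : G.Walk u y) (h : G.Adj y x),
                  p = r.concat h :=
                ⟨_, _, p.adj_penultimate hn, (p.concat_dropLast (p.adj_penultimate hn)).symm⟩
              rw [SimpleGraph.Walk.edges_concat, List.concat_eq_append, altL_snoc] at ha
              have he : Even r.length := by
                rw [SimpleGraph.Walk.length_concat] at hodd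
                by_contra h
                exact (Nat.not_even_iff_odd.2 hodd) (Nat.not_even_iff_odd.1 h).add_one
              have hyM : s(y, x) ∈ M := ha.2.2 (by simpa using he)
              rw [Sym2.eq_swap] at hyM
              have := match_unique hM.1 hyM hin
              subst this
              apply hwp
              simp [SimpleGraph.Walk.support_concat]
            have hcov : Covers M w := by
              by_contra hw
              obtain ⟨k, hk⟩ := hodd
              obtain ⟨M', hM', hu', -⟩ := switch M hM hw (k + 1) (p.concat hxw)
                (by rw [SimpleGraph.Walk.length_concat]; omega) hq (by
                  rw [SimpleGraph.Walk.edges_concat, List.concat_eq_append, altL_snoc]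
                  refine ⟨ha, ?_⟩
                  have : ¬ Even p.length := Nat.not_even_iff_odd.2 ⟨k, hk⟩
                  simp [hxw', this])
              exact hu' (hu M' hM')
            obtain ⟨v, hv, hvM⟩ := covers_nbr hM.1 hcov
            have hvx : v ≠ x := by
              rintro rfl
              rw [Sym2.eq_swap] at hvM
              exact hxw' hvM
            exact ⟨v, by simp [hvx, hv], hM, (hB v hv hvx M).2 ⟨⟨ha, hxw'⟩, hvM⟩⟩
          · rintro ⟨v, hv, hM, h⟩
            simp only [Finset.mem_erase, SimpleGraph.mem_neighborFinset] at hv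
            exact ⟨hM, (hA M).2 ((hB v hv.2 hv.1 M).1 h).1.1⟩
        · intro M v hv v' hv' h h'
          simp only [Finset.mem_erase, SimpleGraph.mem_neighborFinset] at hv hv'
          exact match_unique h.1.1 ((hB v hv.2 hv.1 M).1 h.2).2 ((hB v' hv'.2 hv'.1 M).1 h'.2).2
      have hs : ∀ v ∈ (G.neighborFinset w).erase x, muT G u v =
          -(if G.dist u x % 4 = 1 then 1 else -1) *
            (({M | IsMaximumMatching G M ∧ HasAltPath G M u v}.ncard : ℕ) : ℤ) := by
        intro v hv
        simp only [Finset.mem_erase, SimpleGraph.mem_neighborFinset] at hv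
        rw [muT, dist_eq_len hT _ (hpath v hv.2 hv.1), dist_eq_len hT p hp]
        congr 1
        simp only [SimpleGraph.Walk.length_concat]
        obtain ⟨k, hk⟩ := hodd
        split_ifs <;> first | rfl | omega
      rw [Finset.sum_congr rfl hs, ← Finset.mul_sum, muT, key]
      push_cast
      ring
    · have z : ∀ v (p' : G.Walk u v), p'.IsPath → ¬ Odd p'.length → muT G u v = 0 := by
        intro v p' hp' ho
        have : {M | IsMaximumMatching G M ∧ HasAltPath G M u v} = ∅ := by
          ext M
          simp [hasAlt_iff hT M p' hp', ho]
        rw [muT, this]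
        simp
      rw [z x p hp hodd, Finset.sum_eq_zero, add_zero]
      intro v hv
      simp only [Finset.mem_erase, SimpleGraph.mem_neighborFinset] at hv
      refine z v _ (hpath v hv.2 hv.1) ?_
      simp only [SimpleGraph.Walk.length_concat]
      intro ⟨k, hk⟩
      exact hodd ⟨k - 1, by omega⟩
end

section
/- Let T be a tree with vertex set V and adjacency matrix A, and let f : V → ℝ be an eigenvector of A corresponding to a nonzero eigenvalue. Then for every vertex u of T: Σ_{v∈V} μ_T(u,v) Σ_{w∈T(v)} f(w) = m(T)·f(u). -/
/-! Basic definitions: matchings of a simple graph (as finite sets of edges),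
maximum matchings, the number `m(T)` of maximum matchings, alternating paths,
the quantity `μ_T(u,v)`, and generalized inverses of real symmetric matrices. -/

variable {V : Type*}

/-- the alternation condition alone -/
def AltW (G : SimpleGraph V) (M : Finset (Sym2 V)) {u v : V} (p : G.Walk u v) : Prop :=
  ∀ (i : ℕ) (h : i < p.edges.length), (p.edges.get ⟨i, h⟩ ∈ M ↔ Even i)

theorem altW_nil (G : SimpleGraph V) (M : Finset (Sym2 V)) (u : V) :
    AltW G M (SimpleGraph.Walk.nil : G.Walk u u) := by
  intro i h
  simp at h

theorem altW_concat {G : SimpleGraph V} {M : Finset (Sym2 V)} {u v w : V} (p : G.Walk u v)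
    (h : G.Adj v w) :
    AltW G M (p.concat h) ↔ AltW G M p ∧ (s(v, w) ∈ M ↔ Even p.length) := by
  have hl : p.edges.length = p.length := p.length_edges
  unfold AltW
  simp only [List.get_eq_getElem, SimpleGraph.Walk.edges_concat, List.concat_eq_append]
  constructor
  · intro H
    refine ⟨fun i hi => ?_, ?_⟩
    · have := H i (by simp; omega)
      rwa [List.getElem_append_left hi] at this
    · have := H p.length (by simp)
      rw [List.getElem_append_right (by omega)] at this
      simpa using this
  · rintro ⟨H1, H2⟩ i hi
    simp only [List.length_append, List.length_singleton] at hi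
    by_cases hi' : i < p.edges.length
    · rw [List.getElem_append_left hi']
      exact H1 i hi'
    · have : i = p.length := by omega
      subst this
      rw [List.getElem_append_right (by omega)]
      simpa using H2

theorem altW_congr {G : SimpleGraph V} {M M' : Finset (Sym2 V)} {u v : V} {p : G.Walk u v}
    (h : AltW G M p) (he : ∀ e ∈ p.edges, (e ∈ M ↔ e ∈ M')) : AltW G M' p := by
  intro i hi
  rw [← h i hi]
  exact (he _ (List.get_mem _ _)).symm

theorem AltW.isPath {G : SimpleGraph V} (hG : G.IsAcyclic) {M : Finset (Sym2 V)} {u v : V}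
    {p : G.Walk u v} (h : AltW G M p) : p.IsPath := by
  rw [hG.isPath_iff_isChain, List.isChain_iff_getElem]
  intro i hi heq
  have h1 := h i (by omega)
  have h2 := h (i + 1) (by omega)
  simp only [List.get_eq_getElem] at h1 h2
  rw [← heq, h1] at h2
  grind

theorem path_length_eq_dist {G : SimpleGraph V} (hG : G.IsTree) {u v : V}
    {p : G.Walk u v} (h : p.IsPath) : p.length = G.dist u v := by
  obtain ⟨q, hq, hl⟩ := hG.connected.exists_path_of_dist u v
  rw [← hl, (hG.existsUnique_path u v).unique h hq]

theorem walk_cases_concat {G : SimpleGraph V} {u v : V} (p : G.Walk u v) :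
    (∃ h : u = v, p = h ▸ SimpleGraph.Walk.nil) ∨
      ∃ (x : V) (q : G.Walk u x) (h : G.Adj x v), p = q.concat h := by
  cases p with
  | nil => left; exact ⟨rfl, rfl⟩
  | cons h p =>
    right
    obtain ⟨x, q, h', e⟩ := SimpleGraph.Walk.exists_cons_eq_concat h p
    exact ⟨x, q, h', e⟩

/-- even reachability -/
def EvR (G : SimpleGraph V) (M : Finset (Sym2 V)) (u v : V) : Prop :=
  ∃ p : G.Walk u v, AltW G M p ∧ Even p.length

/-- odd reachability -/
def OdR (G : SimpleGraph V) (M : Finset (Sym2 V)) (u v : V) : Prop :=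
  ∃ p : G.Walk u v, AltW G M p ∧ Odd p.length

theorem hasAltPath_iff {G : SimpleGraph V} (hG : G.IsTree) {M : Finset (Sym2 V)} {u v : V} :
    HasAltPath G M u v ↔ OdR G M u v := by
  constructor
  · rintro ⟨p, h1, h2, h3⟩
    exact ⟨p, h3, h2⟩
  · rintro ⟨p, h3, h2⟩
    exact ⟨p, AltW.isPath hG.isAcyclic h3, h2, h3⟩

theorem IsMatching.unique {G : SimpleGraph V} {M : Finset (Sym2 V)} (hM : IsMatching G M)
    {a b c : V} (h1 : s(a, b) ∈ M) (h2 : s(a, c) ∈ M) : b = c := by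
  by_contra hne
  refine hM.2 _ h1 _ h2 ?_ a ⟨by simp, by simp⟩
  intro h
  rw [Sym2.congr_right] at h
  exact hne h

theorem EvR.dist {G : SimpleGraph V} (hG : G.IsTree) {M : Finset (Sym2 V)} {u v : V}
    (h : EvR G M u v) : Even (G.dist u v) := by
  obtain ⟨p, hp, he⟩ := h
  rwa [← path_length_eq_dist hG (hp.isPath hG.isAcyclic)]

theorem OdR.dist {G : SimpleGraph V} (hG : G.IsTree) {M : Finset (Sym2 V)} {u v : V}
    (h : OdR G M u v) : Odd (G.dist u v) := by
  obtain ⟨p, hp, he⟩ := h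
  rwa [← path_length_eq_dist hG (hp.isPath hG.isAcyclic)]

theorem EvR.step {G : SimpleGraph V} (hG : G.IsTree) {M : Finset (Sym2 V)} 
    (hM : IsMatching G M) {u w v : V} (h : EvR G M u w) (hw : s(w, v) ∈ M) :
    OdR G M u v ∧ G.dist u v = G.dist u w + 1 := by
  obtain ⟨p, hp, he⟩ := h
  have hadj : G.Adj w v := hM.1 _ hw
  have h2 : AltW G M (p.concat hadj) := (altW_concat p hadj).2 ⟨hp, by simp [hw, he]⟩
  refine ⟨⟨_, h2, ?_⟩, ?_⟩
  · simpa using he.add_one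
  · rw [← path_length_eq_dist hG (h2.isPath hG.isAcyclic), 
      ← path_length_eq_dist hG (hp.isPath hG.isAcyclic)]
    simp

theorem OdR.step {G : SimpleGraph V} (hG : G.IsTree) {M : Finset (Sym2 V)} 
    {u w v : V} (h : OdR G M u w) (hadj : G.Adj w v) (hw : s(w, v) ∉ M) :
    EvR G M u v ∧ G.dist u v = G.dist u w + 1 := by
  obtain ⟨p, hp, he⟩ := h
  have h2 : AltW G M (p.concat hadj) := (altW_concat p hadj).2 ⟨hp, by simp [hw, he]⟩
  refine ⟨⟨_, h2, ?_⟩, ?_⟩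
  · simpa using he.add_one
  · rw [← path_length_eq_dist hG (h2.isPath hG.isAcyclic), 
      ← path_length_eq_dist hG (hp.isPath hG.isAcyclic)]
    simp

theorem OdR.back {G : SimpleGraph V} {M : Finset (Sym2 V)} 
    {u v : V} (h : OdR G M u v) : ∃ w, s(w, v) ∈ M ∧ EvR G M u w := by
  obtain ⟨p, hp, he⟩ := h
  rcases walk_cases_concat p with ⟨rfl, rfl⟩ | ⟨x, q, h, rfl⟩
  · simp at he
  · rw [altW_concat] at hp
    have : Even q.length := by
      rw [SimpleGraph.Walk.length_concat] at he
      grind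
    exact ⟨x, hp.2.2 this, q, hp.1, this⟩

theorem EvR.back {G : SimpleGraph V} {M : Finset (Sym2 V)} 
    {u v : V} (h : EvR G M u v) : u = v ∨ ∃ w, G.Adj w v ∧ s(w, v) ∉ M ∧ OdR G M u w := by
  obtain ⟨p, hp, he⟩ := h
  rcases walk_cases_concat p with ⟨rfl, rfl⟩ | ⟨x, q, h, rfl⟩
  · left; rfl
  · right
    rw [altW_concat] at hp
    have : Odd q.length := by
      rw [SimpleGraph.Walk.length_concat] at he
      grind
    refine ⟨x, h, fun hx => ?_, q, hp.1, this⟩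
    have := hp.2.1 hx
    grind

theorem OdR.unique {G : SimpleGraph V} (hG : G.IsTree) {M : Finset (Sym2 V)} 
    {u v w w' : V} (h : OdR G M u w) (hadj : G.Adj w v) (hw : s(w, v) ∉ M)
    (h' : OdR G M u w') (hadj' : G.Adj w' v) (hw' : s(w', v) ∉ M) : w = w' := by
  obtain ⟨p, hp, he⟩ := h
  obtain ⟨p', hp', he'⟩ := h'
  have h2 : AltW G M (p.concat hadj) := (altW_concat p hadj).2 ⟨hp, by simp [hw, he]⟩
  have h2' : AltW G M (p'.concat hadj') := (altW_concat p' hadj').2 ⟨hp', by simp [hw', he']⟩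
  have := (hG.existsUnique_path u v).unique (h2.isPath hG.isAcyclic) (h2'.isPath hG.isAcyclic)
  obtain ⟨h, -⟩ := SimpleGraph.Walk.concat_inj this
  exact h

open Classical in
/-- signed even indicator -/
noncomputable def aa (G : SimpleGraph V) (u : V) (M : Finset (Sym2 V)) (w : V) : ℝ :=
  if EvR G M u w then (-1) ^ (G.dist u w / 2) else 0

open Classical in
/-- signed odd indicator -/
noncomputable def bb (G : SimpleGraph V) (u : V) (M : Finset (Sym2 V)) (w : V) : ℝ :=
  if OdR G M u w then (-1) ^ (G.dist u w / 2) else 0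

theorem bb_eq_aa {G : SimpleGraph V} (hG : G.IsTree) {M : Finset (Sym2 V)} 
    (hM : IsMatching G M) {u w v : V} (hw : s(w, v) ∈ M) : bb G u M v = aa G u M w := by
  unfold bb aa
  by_cases h : EvR G M u w
  · obtain ⟨h1, h2⟩ := h.step hG hM hw
    have := h.dist hG
    rw [if_pos h, if_pos h1, h2]
    congr 1
    grind
  · rw [if_neg h, if_neg]
    intro h1
    obtain ⟨w', hw', h'⟩ := h1.back
    rw [Sym2.eq_swap] at hw hw'
    rw [hM.unique hw hw'] at h
    exact h h'

open Classical in
theorem aa_eq [Fintype V] {G : SimpleGraph V} (hG : G.IsTree) {M : Finset (Sym2 V)} 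
    (u w : V) : (∑ v : V, if G.Adj v w ∧ s(v, w) ∉ M then bb G u M v else 0)
      = (if u = w then 1 else 0) - aa G u M w := by
  by_cases h : EvR G M u w
  · rcases h.back with rfl | ⟨v, h1, h2, h3⟩
    · have : aa G u M u = 1 := by simp [aa, h]
      rw [this]
      simp only [if_true, sub_self]
      apply Finset.sum_eq_zero
      intro v _
      split_ifs with hv
      · unfold bb
        rw [if_neg]
        intro h3
        have := (h3.step hG hv.1 hv.2).2
        simp at this
      · rfl
    · have hs := h3.step hG h1 h2
      rw [Finset.sum_eq_single v]
      · have hne : u ≠ w := by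
          rintro rfl
          simp at hs
        have hd := h3.dist hG
        rw [if_pos ⟨h1, h2⟩, if_neg hne, aa, bb, if_pos h, if_pos h3, hs.2, zero_sub]
        have : (G.dist u v + 1) / 2 = G.dist u v / 2 + 1 := by grind
        rw [this, pow_succ]
        ring
      · intro v' _ hne
        split_ifs with hv
        · unfold bb
          rw [if_neg]
          intro h3'
          exact hne (h3'.unique hG hv.1 hv.2 h3 h1 h2)
        · rfl
      · simp
  · have hne : u ≠ w := by
      rintro rfl
      exact h ⟨_, altW_nil G M u, by simp⟩
    rw [aa, if_neg h, if_neg hne, sub_zero]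
    apply Finset.sum_eq_zero
    intro v _
    split_ifs with hv
    · unfold bb
      rw [if_neg]
      intro h3
      exact h (h3.step hG hv.1 hv.2).1
    · rfl

open Classical in
theorem bb_match [Fintype V] {G : SimpleGraph V} (hG : G.IsTree) {M : Finset (Sym2 V)} 
    (hM : IsMatching G M) (u w : V) :
    (∑ v : V, if s(v, w) ∈ M then bb G u M v else 0)
      = if Covers M w then aa G u M w else 0 := by
  split_ifs with h
  · obtain ⟨e, he, hw⟩ := h
    obtain ⟨v, rfl⟩ := hw
    rw [Finset.sum_eq_single v]
    · rw [if_pos (by rwa [Sym2.eq_swap]), bb_eq_aa hG hM he]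
    · intro v' _ hne
      rw [if_neg]
      intro h'
      rw [Sym2.eq_swap] at h'
      exact hne (hM.unique h' he)
    · simp
  · apply Finset.sum_eq_zero
    intro v _
    rw [if_neg]
    intro h'
    exact h ⟨_, h', by simp⟩

open Classical in
theorem bb_sum [Fintype V] {G : SimpleGraph V} (hG : G.IsTree) {M : Finset (Sym2 V)} 
    (hM : IsMatching G M) (u w : V) :
    (∑ v : V, if G.Adj v w then bb G u M v else 0)
      = (if u = w then 1 else 0) - if Covers M w then 0 else aa G u M w := by
  have h1 := aa_eq hG (M := M) u w
  have h2 := bb_match hG hM u w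
  have h3 : (∑ v : V, if G.Adj v w then bb G u M v else 0) =
    (∑ v : V, if G.Adj v w ∧ s(v, w) ∉ M then bb G u M v else 0) +
    (∑ v : V, if s(v, w) ∈ M then bb G u M v else 0) := by
    rw [← Finset.sum_add_distrib]
    refine Finset.sum_congr rfl fun v _ => ?_
    by_cases hm : s(v, w) ∈ M
    · have : G.Adj v w := hM.1 _ hm
      simp [hm, this]
    · simp [hm]
  rw [h3, h1, h2]
  split_ifs <;> ring

theorem max_cover [DecidableEq V] {G : SimpleGraph V} {M : Finset (Sym2 V)} 
    (hM : IsMaximumMatching G M) {w x : V} (h : G.Adj w x) (hw : ¬ Covers M w) :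
    ∃ y, s(x, y) ∈ M := by
  by_contra hx
  have hx' : ¬ Covers M x := by
    rintro ⟨e, he, ⟨y, rfl⟩⟩
    exact hx ⟨y, he⟩
  have hn : s(w, x) ∉ M := fun h' => hw ⟨_, h', by simp⟩
  have := hM.2 (insert s(w, x) M) ⟨?_, ?_⟩
  · rw [Finset.card_insert_of_notMem hn] at this
    omega
  · intro e he
    rcases Finset.mem_insert.1 he with rfl | he
    · exact h
    · exact hM.1.1 e he
  · have key : ∀ f ∈ M, ∀ v, ¬ (v ∈ s(w, x) ∧ v ∈ f) := by
      rintro f hf v ⟨h1, h2⟩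
      rcases Sym2.mem_iff.1 h1 with rfl | rfl
      · exact hw ⟨f, hf, h2⟩
      · exact hx' ⟨f, hf, h2⟩
    intro e he f hf hne v hv
    rcases Finset.mem_insert.1 he with rfl | he <;> rcases Finset.mem_insert.1 hf with rfl | hf
    · exact hne rfl
    · exact key f hf v hv
    · exact key e he v hv.symm
    · exact hM.1.2 e he f hf hne v hv

/-- swap an edge -/
def swp [DecidableEq V] (M : Finset (Sym2 V)) (x w y : V) : Finset (Sym2 V) :=
  insert s(x, w) (M.erase s(x, y))

section swap
variable [DecidableEq V] {G : SimpleGraph V} {M : Finset (Sym2 V)} {w x y u : V}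

theorem swp_max (hM : IsMaximumMatching G M) (h : G.Adj w x) (hw : ¬ Covers M w)
    (hy : s(x, y) ∈ M) : IsMaximumMatching G (swp M x w y) := by
  have hn : s(x, w) ∉ M := fun h' => hw ⟨_, h', by simp⟩
  have hcard : (swp M x w y).card = M.card := by
    unfold swp
    rw [Finset.card_insert_of_notMem (fun h => hn (Finset.mem_of_mem_erase h)),
      Finset.card_erase_add_one hy]
  refine ⟨⟨?_, ?_⟩, fun M' hM' => hcard ▸ hM.2 M' hM'⟩
  · intro e he
    rcases Finset.mem_insert.1 he with rfl | he
    · exact h.symm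
    · exact hM.1.1 e (Finset.mem_of_mem_erase he)
  · have key : ∀ f ∈ M.erase s(x, y), ∀ v, ¬ (v ∈ s(x, w) ∧ v ∈ f) := by
      rintro f hf v ⟨h1, h2⟩
      obtain ⟨hf1, hf2⟩ := Finset.mem_erase.1 hf
      rcases Sym2.mem_iff.1 h1 with rfl | rfl
      · exact hM.1.2 _ hf2 _ hy hf1 v ⟨h2, by simp⟩
      · exact hw ⟨f, hf2, h2⟩
    intro e he f hf hne v hv
    rcases Finset.mem_insert.1 he with rfl | he <;> rcases Finset.mem_insert.1 hf with rfl | hf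
    · exact hne rfl
    · exact key f hf v hv
    · exact key e he v hv.symm
    · exact hM.1.2 e (Finset.mem_of_mem_erase he) f (Finset.mem_of_mem_erase hf) hne v hv

theorem swp_ne (hw : ¬ Covers M w) (hy : s(x, y) ∈ M) : y ≠ w := by
  rintro rfl
  exact hw ⟨_, hy, by simp⟩

theorem swp_notCovers (hM : IsMaximumMatching G M) (hw : ¬ Covers M w)
    (hy : s(x, y) ∈ M) : ¬ Covers (swp M x w y) y := by
  have hxy : G.Adj x y := hM.1.1 _ hy
  rintro ⟨e, he, hye⟩
  rcases Finset.mem_insert.1 he with rfl | he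
  · rcases Sym2.mem_iff.1 hye with h | h
    · exact hxy.ne h.symm
    · exact swp_ne hw hy h
  · obtain ⟨hf1, hf2⟩ := Finset.mem_erase.1 he
    exact hM.1.2 _ hf2 _ hy hf1 y ⟨hye, by simp⟩

theorem swp_swp (hw : ¬ Covers M w) (hy : s(x, y) ∈ M) :
    swp (swp M x w y) x y w = M := by
  have hn : s(x, w) ∉ M := fun h' => hw ⟨_, h', by simp⟩
  unfold swp
  rw [Finset.erase_insert (fun h => hn (Finset.mem_of_mem_erase h)), Finset.insert_erase hy]

theorem swp_mem {e : Sym2 V} (he : x ∉ e) : e ∈ M ↔ e ∈ swp M x w y := by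
  have h1 : e ≠ s(x, w) := by rintro rfl; simp at he
  have h2 : e ≠ s(x, y) := by rintro rfl; simp at he
  simp [swp, h1, h2]

theorem altW_swp {v : V} {p : G.Walk u v} (hp : AltW G M p) (hx : x ∉ p.support) :
    AltW G (swp M x w y) p := by
  refine altW_congr hp fun e he => swp_mem fun hxe => ?_
  obtain ⟨z, rfl⟩ := hxe
  exact hx (p.fst_mem_support_of_mem_edges he)

theorem swp_EvR (hG : G.IsTree) (hM : IsMaximumMatching G M) (h : G.Adj w x)
    (hw : ¬ Covers M w) (hy : s(x, y) ∈ M) (hE : EvR G M u w) :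
    EvR G (swp M x w y) u y ∧
      (G.dist u y = G.dist u w + 2 ∨ G.dist u w = G.dist u y + 2) := by
  have hxy : G.Adj x y := hM.1.1 _ hy
  have hn : s(w, x) ∉ M := fun h' => hw ⟨_, h', by simp⟩
  have hne := swp_ne hw hy
  obtain ⟨p, hp, he⟩ := hE
  have hpp := hp.isPath hG.isAcyclic
  by_cases hx : x ∈ p.support
  · have hq : (p.takeUntil x hx).IsPath := hpp.takeUntil hx
    have hpq := hG.isAcyclic.path_concat hq hpp h.symm hx
    generalize p.takeUntil x hx = q at hq hpq
    subst hpq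
    rw [altW_concat] at hp
    have hqo : Odd q.length := by
      rw [SimpleGraph.Walk.length_concat] at he
      grind
    obtain ⟨hpa, hpb⟩ := hp
    rcases walk_cases_concat q with ⟨rfl, rfl⟩ | ⟨z, r, hz, rfl⟩
    · simp at hqo
    · rw [altW_concat] at hpa
      have hre : Even r.length := by
        rw [SimpleGraph.Walk.length_concat] at hqo
        grind
      have hzx : s(x, z) ∈ M := by
        rw [Sym2.eq_swap]
        exact hpa.2.2 hre
      obtain rfl : z = y := hM.1.unique hzx hy
      rw [SimpleGraph.Walk.concat_isPath_iff] at hq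
      refine ⟨⟨r, altW_swp hpa.1 hq.2, hre⟩, Or.inr ?_⟩
      rw [← path_length_eq_dist hG hq.1, ← path_length_eq_dist hG hpp]
      simp
  · have h0 := altW_swp (w := w) (y := y) hp hx
    have h1 : AltW G (swp M x w y) (p.concat h) := (altW_concat p h).2 ⟨h0, by
      simp [he, swp, Sym2.eq_swap]⟩
    have h2 : AltW G (swp M x w y) ((p.concat h).concat hxy) := (altW_concat _ hxy).2 ⟨h1, by
      have : s(x, y) ≠ s(x, w) := fun h => hne (Sym2.congr_right.1 h)
      simp [swp, this, he, parity_simps]⟩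
    refine ⟨⟨_, h2, by simpa [parity_simps] using he⟩, Or.inl ?_⟩
    rw [← path_length_eq_dist hG (h2.isPath hG.isAcyclic), ← path_length_eq_dist hG hpp]
    simp
end swap

open Classical in
theorem inv_sum [Fintype V] {G : SimpleGraph V} (hG : G.IsTree) (u x : V) :
    ∑ q ∈ (Finset.univ : Finset (Finset (Sym2 V) × V)).filter
      (fun q => IsMaximumMatching G q.1 ∧ G.Adj q.2 x ∧ ¬ Covers q.1 q.2 ∧ EvR G q.1 u q.2),
      aa G u q.1 q.2 = 0 := by
  have H : ∀ q ∈ (Finset.univ : Finset (Finset (Sym2 V) × V)).filter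
      (fun q => IsMaximumMatching G q.1 ∧ G.Adj q.2 x ∧ ¬ Covers q.1 q.2 ∧ EvR G q.1 u q.2),
      ∃ y, s(x, y) ∈ q.1 := by
    intro q hq
    obtain ⟨-, h1, h2, h3, h4⟩ := Finset.mem_filter.1 hq
    exact max_cover h1 h2 h3
  haveI : Nonempty V := ⟨u⟩
  choose! y hy using H
  refine Finset.sum_involution (fun q _ => (swp q.1 x q.2 (y q), y q)) ?_ ?_ ?_ ?_
  · intro q hq
    have hyq := hy q hq
    obtain ⟨-, h1, h2, h3, h4⟩ := Finset.mem_filter.1 hq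
    obtain ⟨h5, h6⟩ := swp_EvR hG h1 h2 h3 hyq h4
    simp only [aa]
    rw [if_pos h4, if_pos h5]
    rcases h6 with h6 | h6
    · have : (G.dist u q.2 + 2) / 2 = G.dist u q.2 / 2 + 1 := by omega
      rw [h6, this, pow_succ]
      ring
    · have : (G.dist u (y q) + 2) / 2 = G.dist u (y q) / 2 + 1 := by omega
      rw [h6, this, pow_succ]
      ring
  · intro q hq _ heq
    have hyq := hy q hq
    obtain ⟨-, h1, h2, h3, h4⟩ := Finset.mem_filter.1 hq
    exact swp_ne h3 hyq (congrArg Prod.snd heq)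
  · intro q hq
    have hyq := hy q hq
    obtain ⟨-, h1, h2, h3, h4⟩ := Finset.mem_filter.1 hq
    have hadj : G.Adj x (y q) := h1.1.1 _ hyq
    exact Finset.mem_filter.2 ⟨Finset.mem_univ _, swp_max h1 h2 h3 hyq, hadj.symm,
      swp_notCovers h1 h3 hyq, (swp_EvR hG h1 h2 h3 hyq h4).1⟩
  · intro q hq
    have hyq := hy q hq
    obtain ⟨-, h1, h2, h3, h4⟩ := Finset.mem_filter.1 hq
    have hadj : G.Adj x (y q) := h1.1.1 _ hyq
    have hm := swp_max h1 h2 h3 hyq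
    have hq' : (swp q.1 x q.2 (y q), y q) ∈ (Finset.univ : Finset (Finset (Sym2 V) × V)).filter
      (fun q => IsMaximumMatching G q.1 ∧ G.Adj q.2 x ∧ ¬ Covers q.1 q.2 ∧ EvR G q.1 u q.2) :=
      Finset.mem_filter.2 ⟨Finset.mem_univ _, hm, hadj.symm,
      swp_notCovers h1 h3 hyq, (swp_EvR hG h1 h2 h3 hyq h4).1⟩
    have hyy := hy _ hq'
    have : y (swp q.1 x q.2 (y q), y q) = q.2 :=
      hm.1.unique hyy (Finset.mem_insert_self _ _)
    simp only [this]
    rw [swp_swp h3 hyq]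

open Classical in
theorem inv_sum2 [Fintype V] {G : SimpleGraph V} (hG : G.IsTree) (u x : V) :
    ∑ M ∈ (Finset.univ : Finset (Finset (Sym2 V))).filter (IsMaximumMatching G),
      ∑ w : V, (if G.Adj w x then (if Covers M w then 0 else aa G u M w) else 0) = 0 := by
  refine Eq.trans ?_ (inv_sum hG u x)
  rw [Finset.sum_filter, Finset.sum_filter, ← Finset.univ_product_univ,
    Finset.sum_product]
  refine Finset.sum_congr rfl fun M _ => ?_
  by_cases hM : IsMaximumMatching G M
  · simp only [hM, if_true, true_and]
    refine Finset.sum_congr rfl fun w _ => ?_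
    by_cases h1 : G.Adj w x <;> by_cases h2 : Covers M w <;> by_cases h3 : EvR G M u w <;>
      simp [h1, h2, h3, aa]
  · simp [hM]

open Classical in
theorem muT_eq [Fintype V] {G : SimpleGraph V} (hG : G.IsTree) (u v : V) :
    (muT G u v : ℝ) =
      ∑ M ∈ (Finset.univ : Finset (Finset (Sym2 V))).filter (IsMaximumMatching G),
        bb G u M v := by
  have h1 : {M : Finset (Sym2 V) | IsMaximumMatching G M ∧ HasAltPath G M u v} =
      (((Finset.univ : Finset (Finset (Sym2 V))).filter (IsMaximumMatching G)).filter
        (fun M => OdR G M u v) : Finset (Finset (Sym2 V))) := by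
    ext M
    simp [hasAltPath_iff hG]
  unfold muT
  rw [h1, Set.ncard_coe_finset]
  simp only [bb]
  rw [← Finset.sum_filter, Finset.sum_const, nsmul_eq_mul]
  set S := ((Finset.univ : Finset (Finset (Sym2 V))).filter (IsMaximumMatching G)).filter
        (fun M => OdR G M u v) with hS
  by_cases hemp : S = ∅
  · simp [hemp]
  · obtain ⟨M, hM⟩ := Finset.nonempty_iff_ne_empty.2 hemp
    have hd := ((Finset.mem_filter.1 hM).2).dist hG
    have : (((if G.dist u v % 4 = 1 then 1 else -1 : ℤ)) : ℝ) = (-1) ^ (G.dist u v / 2) := by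
      split_ifs with h
      · have : Even (G.dist u v / 2) := by rw [Nat.even_iff]; omega
        simp [this.neg_one_pow]
      · have : Odd (G.dist u v / 2) := by
          rw [Nat.odd_iff] at hd ⊢; omega
        simp [this.neg_one_pow]
    push_cast at this ⊢
    rw [this]
    ring


/-- Let `T` be a tree with vertex set `V` and adjacency matrix `A`, and let
`f : V → ℝ` be an eigenvector of `A` corresponding to a nonzero eigenvalue. Then for every
vertex `u`: `∑_{v∈V} μ_T(u,v) ∑_{w∈T(v)} f(w) = m(T)·f(u)`. -/
theorem stmt8 {V : Type*} [Fintype V] [DecidableEq V] (G : SimpleGraph V)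
    [DecidableRel G.Adj] (hT : G.IsTree) (hV : 2 ≤ Fintype.card V)
    (f : V → ℝ) (l : ℝ) (hl : l ≠ 0) (hf : f ≠ 0)
    (heig : (G.adjMatrix ℝ).mulVec f = l • f) (u : V) :
    ∑ v : V, (muT G u v : ℝ) * ∑ w ∈ G.neighborFinset v, f w
      = (numMaxMatchings G : ℝ) * f u := by
  classical
  have hnum : (numMaxMatchings G : ℝ) * f u = ∑ M ∈ (Finset.univ :
      Finset (Finset (Sym2 V))).filter (fun M => IsMaximumMatching G M), f u := by
    have h1 : {M : Finset (Sym2 V) | IsMaximumMatching G M} =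
      ((Finset.univ : Finset (Finset (Sym2 V))).filter (fun M => IsMaximumMatching G M) :
        Finset (Finset (Sym2 V))) := by
      ext M
      simp
    unfold numMaxMatchings
    rw [h1, Set.ncard_coe_finset, Finset.sum_const, nsmul_eq_mul]
  have hadj : ∀ v, ∑ w ∈ G.neighborFinset v, f w = ∑ w, if G.Adj v w then f w else 0 := by
    intro v
    rw [← Finset.sum_filter]
    congr 1
    ext w
    simp
  have hev : ∀ v, l * f v = ∑ w, if G.Adj v w then f w else 0 := by
    intro v
    have := congrFun heig v
    rw [SimpleGraph.adjMatrix_mulVec_apply, hadj] at this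
    simpa using this.symm
  have hzero : ∑ M ∈ (Finset.univ : Finset (Finset (Sym2 V))).filter
      (fun M => IsMaximumMatching G M),
      ∑ w : V, (if Covers M w then 0 else aa G u M w) * f w = 0 := by
    apply (mul_eq_zero.1 (?_ : l * _ = 0)).resolve_left hl
    calc _ = ∑ x : V, f x * ∑ M ∈ (Finset.univ : Finset (Finset (Sym2 V))).filter
              (fun M => IsMaximumMatching G M),
              ∑ w : V, (if G.Adj w x then (if Covers M w then 0 else aa G u M w) else 0) := by
            simp_rw [Finset.mul_sum]
            rw [Finset.sum_comm' (t' := Finset.univ.filter (fun M => IsMaximumMatching G M))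
              (s' := fun _ => Finset.univ) (by simp)]
            refine Finset.sum_congr rfl fun M _ => ?_
            rw [Finset.sum_comm]
            refine Finset.sum_congr rfl fun w _ => ?_
            rw [mul_left_comm, hev, Finset.mul_sum]
            refine Finset.sum_congr rfl fun x _ => ?_
            split_ifs <;> ring
      _ = 0 := by
            refine Finset.sum_eq_zero fun x _ => ?_
            have := inv_sum2 hT u x
            rw [mul_eq_zero]
            right
            convert this
  rw [hnum, ← sub_zero (∑ M ∈ _, f u), ← hzero, ← Finset.sum_sub_distrib]
  simp_rw [muT_eq hT, hadj, Finset.sum_mul]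
  rw [Finset.sum_comm]
  refine Finset.sum_congr (by congr) fun M hM => ?_
  have hM' : IsMatching G M := ((Finset.mem_filter.1 hM).2).1
  calc _ = ∑ w, (∑ v : V, if G.Adj v w then bb G u M v else 0) * f w := by
        simp_rw [Finset.mul_sum, Finset.sum_mul]
        rw [Finset.sum_comm]
        refine Finset.sum_congr rfl fun w _ => Finset.sum_congr rfl fun v _ => ?_
        split_ifs <;> simp
    _ = ∑ w, ((if u = w then 1 else 0) - if Covers M w then 0 else aa G u M w) * f w := by
        refine Finset.sum_congr rfl fun w _ => ?_
        congr 1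
        convert bb_sum hT hM' u w
    _ = _ := by
        simp_rw [sub_mul]
        rw [Finset.sum_sub_distrib]
        simp
end

section
/- Let A be the adjacency matrix of a tree T with vertex set V, and let C be the integer matrix indexed by V with entries C_{uv} = μ_T(u,v). Then A and C have the same row space over the rationals (equivalently, each row of C is a rational linear combination of rows of A and vice versa; in particular A and C have the same null space). -/
/-! Basic definitions: matchings of a simple graph (as finite sets of edges),
maximum matchings, the number `m(T)` of maximum matchings, alternating paths,
the quantity `μ_T(u,v)`, and generalized inverses of real symmetric matrices. -/

variable {V : Type*}

namespace S9
open Finset SimpleGraph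
open scoped Classical

noncomputable def cnt [Fintype V] (G : SimpleGraph V) (S : Finset V) (c d : ℕ) : ℕ :=
  #{M : Finset (Sym2 V) | IsMatching G M ∧ (∀ e ∈ M, ∀ x ∈ S, x ∉ e) ∧ 2 * #M + d = c}

theorem matching_mono {G : SimpleGraph V} {M N : Finset (Sym2 V)} (h : IsMatching G M)
    (hN : N ⊆ M) : IsMatching G N :=
  ⟨fun e he => h.1 e (hN he), fun e he f hf => h.2 e (hN he) f (hN hf)⟩

theorem matching_union {G : SimpleGraph V} {M N : Finset (Sym2 V)} (h : IsMatching G M)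
    (h' : IsMatching G N) (hd : ∀ e ∈ M, ∀ f ∈ N, ∀ x, x ∈ e → x ∉ f) : IsMatching G (M ∪ N) := by
  refine ⟨fun e he => ?_, fun e he f hf hne x hx => ?_⟩
  · rcases mem_union.1 he with he | he
    · exact h.1 e he
    · exact h'.1 e he
  · rcases mem_union.1 he with he | he <;> rcases mem_union.1 hf with hf | hf
    · exact h.2 e he f hf hne x hx
    · exact hd e he f hf x hx.1 hx.2
    · exact hd f hf e he x hx.2 hx.1
    · exact h'.2 e he f hf hne x hx

theorem matching_single {G : SimpleGraph V} {u w : V} (h : G.Adj u w) :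
    IsMatching G {s(u, w)} := by
  refine ⟨fun e he => ?_, fun e he f hf hne => ?_⟩
  · rw [mem_singleton.1 he]; exact h
  · exact absurd ((mem_singleton.1 he).trans (mem_singleton.1 hf).symm) hne

theorem disj_of {M N : Finset (Sym2 V)} (hd : ∀ e ∈ M, ∀ f ∈ N, ∀ x, x ∈ e → x ∉ f) :
    Disjoint M N := by
  rw [Finset.disjoint_left]
  intro e he hf
  induction e with
  | _ a b => exact hd _ he _ hf a (by simp) (by simp)

theorem cnt_rec [Fintype V] (G : SimpleGraph V) (S : Finset V) (c d : ℕ) (u : V) (hu : u ∉ S) :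
    cnt G S c d = cnt G (insert u S) c d +
      ∑ w ∈ {w : V | G.Adj u w ∧ w ∉ S}, cnt G (insert w (insert u S)) c (d + 2) := by
  unfold cnt
  rw [← Finset.card_filter_add_card_filter_not (fun M : Finset (Sym2 V) => ¬ Covers M u)]
  congr 1
  · congr 1
    ext M
    simp only [Finset.mem_filter, Finset.mem_univ, true_and, Covers, Finset.mem_insert]
    grind
  · have : (Finset.filter (fun M : Finset (Sym2 V) => ¬ ¬ Covers M u)
        {M : Finset (Sym2 V) | IsMatching G M ∧ (∀ e ∈ M, ∀ x ∈ S, x ∉ e) ∧ 2 * #M + d = c}) =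
        Finset.biUnion {w : V | G.Adj u w ∧ w ∉ S} (fun w => {M : Finset (Sym2 V) |
          (IsMatching G M ∧ (∀ e ∈ M, ∀ x ∈ S, x ∉ e) ∧ 2 * #M + d = c) ∧ s(u, w) ∈ M}) := by
      ext M
      simp only [Finset.mem_filter, Finset.mem_univ, true_and, Covers, Finset.mem_biUnion, not_not]
      constructor
      · rintro ⟨h, e, he, hue⟩
        obtain ⟨w, rfl⟩ := Sym2.mem_iff_exists.1 hue
        refine ⟨w, ⟨h.1.1 _ he, fun hw => h.2.1 _ he w hw (by simp)⟩, h, he⟩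
      · rintro ⟨w, hw, h, he⟩
        exact ⟨h, _, he, by simp⟩
    rw [this, Finset.card_biUnion]
    · refine Finset.sum_congr rfl fun w hw => ?_
      simp only [Finset.mem_filter, Finset.mem_univ, true_and] at hw
      refine Finset.card_bij' (fun M _ => M.erase s(u, w)) (fun M _ => M ∪ {s(u, w)}) ?_ ?_ ?_ ?_
      · intro M hM
        simp only [Finset.mem_filter, Finset.mem_univ, true_and] at hM ⊢
        obtain ⟨⟨h1, h2, h3⟩, h4⟩ := hM
        refine ⟨matching_mono h1 (erase_subset _ _), ?_, ?_⟩
        · intro e he x hx hxe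
          rw [mem_erase] at he
          simp only [Finset.mem_insert] at hx
          rcases hx with rfl | rfl | hx
          · exact h1.2 e he.2 _ h4 he.1 x ⟨hxe, by simp⟩
          · exact h1.2 e he.2 _ h4 he.1 x ⟨hxe, by simp⟩
          · exact h2 e he.2 x hx hxe
        · have := Finset.card_erase_add_one h4
          omega
      · intro M hM
        simp only [Finset.mem_filter, Finset.mem_univ, true_and] at hM ⊢
        obtain ⟨h1, h2, h3⟩ := hM
        have hd : ∀ e ∈ M, ∀ f ∈ ({s(u, w)} : Finset (Sym2 V)), ∀ x, x ∈ e → x ∉ f := by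
          intro e he f hf x hx hxf
          rw [mem_singleton.1 hf, Sym2.mem_iff] at hxf
          rcases hxf with rfl | rfl
          · exact h2 e he x (by simp) hx
          · exact h2 e he x (by simp) hx
        refine ⟨⟨matching_union h1 (matching_single hw.1) hd, ?_, ?_⟩, by simp⟩
        · intro e he x hx hxe
          rcases mem_union.1 he with he | he
          · exact h2 e he x (by simp [hx]) hxe
          · rw [mem_singleton.1 he, Sym2.mem_iff] at hxe
            rcases hxe with rfl | rfl
            · exact hu hx
            · exact hw.2 hx
        · rw [card_union_of_disjoint (disj_of hd), card_singleton]
          omega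
      · intro M hM
        simp only [Finset.mem_filter, Finset.mem_univ, true_and] at hM
        ext e
        simp only [mem_union, mem_erase, mem_singleton]
        constructor
        · rintro (h | rfl)
          · exact h.2
          · exact hM.2
        · intro h
          by_cases h' : e = s(u, w)
          · exact Or.inr h'
          · exact Or.inl ⟨h', h⟩
      · intro M hM
        simp only [Finset.mem_filter, Finset.mem_univ, true_and] at hM
        ext e
        simp only [mem_union, mem_erase, mem_singleton]
        constructor
        · rintro ⟨h, h' | h'⟩
          · exact h'
          · exact absurd h' h
        · intro h
          refine ⟨?_, Or.inl h⟩
          rintro rfl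
          exact hM.2.1 _ h u (by simp) (by simp)
    · intro w hw w' hw' hne
      rw [Function.onFun, Finset.disjoint_left]
      intro M hM hM'
      simp only [Finset.mem_filter, Finset.mem_univ, true_and] at hM hM'
      refine hM.1.1.2 _ hM.2 _ hM'.2 ?_ u ⟨by simp, by simp⟩
      intro h
      exact hne (Sym2.congr_right.1 h)

theorem cnt_shift [Fintype V] (G : SimpleGraph V) (S : Finset V) (c d : ℕ) :
    cnt G S (c + 1) (d + 1) = cnt G S c d := by
  unfold cnt
  congr 1
  ext M
  simp only [Finset.mem_filter, Finset.mem_univ, true_and]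
  have : 2 * #M + (d + 1) = c + 1 ↔ 2 * #M + d = c := by omega
  rw [this]

theorem evens {G : SimpleGraph V} : ∀ (n : ℕ) {u v : V} (p : G.Walk u v), p.length = 2 * n + 1 →
    p.IsPath → ∃ E : Finset (Sym2 V), IsMatching G E ∧ (∀ e ∈ E, e ∈ p.edges) ∧
      (∀ x ∈ p.support, ∃ e ∈ E, x ∈ e) ∧ 2 * #E = p.length + 1 ∧
      ∀ (i : ℕ) (h : i < p.edges.length), (p.edges.get ⟨i, h⟩ ∈ E ↔ Even i) := by
  intro n
  induction n with
  | zero =>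
    intro u v p hl hp
    match p, hl with
    | .cons h .nil, hl =>
      refine ⟨{s(u, v)}, matching_single h, by simp, by simp, by simp, ?_⟩
      intro i hi
      simp at hi
      subst hi
      simp
  | succ n ih =>
    intro u v p hl hp
    match p, hl with
    | .cons (v := a) h (.cons (v := b) h' q), hl =>
      simp only [Walk.length_cons] at hl
      simp only [Walk.cons_isPath_iff, Walk.support_cons, List.mem_cons, not_or] at hp
      obtain ⟨⟨hq, ha⟩, hua, hu⟩ := hp
      obtain ⟨E, h1, h2, h3, h4, h5⟩ := ih q (by omega) hq
      have hE : ∀ e ∈ E, ∀ x ∈ e, x ∈ q.support := by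
        intro e he x hx
        exact Walk.mem_support_of_mem_edges (h2 e he) hx
      have hd : ∀ e ∈ ({s(u, a)} : Finset (Sym2 V)), ∀ f ∈ E, ∀ x, x ∈ e → x ∉ f := by
        intro e he f hf x hx hxf
        rw [mem_singleton.1 he, Sym2.mem_iff] at hx
        rcases hx with rfl | rfl
        · exact hu (hE f hf _ hxf)
        · exact ha (hE f hf _ hxf)
      refine ⟨{s(u, a)} ∪ E, matching_union (matching_single h) h1 hd, ?_, ?_, ?_, ?_⟩
      · intro e he
        rcases mem_union.1 he with he | he
        · simp [mem_singleton.1 he]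
        · simp [h2 e he]
      · intro x hx
        simp only [Walk.support_cons, List.mem_cons] at hx
        rcases hx with rfl | rfl | hx
        · exact ⟨s(x, a), by simp, by simp⟩
        · exact ⟨s(u, x), by simp, by simp⟩
        · obtain ⟨e, he, hx⟩ := h3 x hx
          exact ⟨e, mem_union_right _ he, hx⟩
      · rw [card_union_of_disjoint (disj_of hd), card_singleton]
        simp only [Walk.length_cons]
        omega
      · intro i hi
        match i, hi with
        | 0, hi => simp
        | 1, hi =>
          have hb : u ≠ b := fun hb => hu (hb ▸ q.start_mem_support)
          have : s(a, b) ∉ E := fun hm => ha (hE _ hm a (by simp))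
          simp [this]
          exact ⟨fun h => absurd h.symm hua, fun h => absurd h.symm hb⟩
        | i + 2, hi =>
          have hi' : i < q.edges.length := by simpa using hi
          have h6 := h5 i hi'
          have : q.edges.get ⟨i, hi'⟩ ≠ s(u, a) := by
            intro h
            have := List.get_mem q.edges ⟨i, hi'⟩
            rw [h] at this
            exact hu (Walk.mem_support_of_mem_edges this (by simp))
          have h7 : (Walk.cons h (Walk.cons h' q)).edges.get ⟨i + 2, hi⟩ = q.edges.get ⟨i, hi'⟩ := rfl
          rw [h7, mem_union, h6, mem_singleton]
          simp only [this, false_or]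
          grind

theorem alt_iff {G : SimpleGraph V} {u v : V} (p : G.Walk u v) (hp : p.IsPath) (ho : Odd p.length)
    {E M : Finset (Sym2 V)} (hM : IsMatching G M) (h2 : ∀ e ∈ E, e ∈ p.edges)
    (h3 : ∀ x ∈ p.support, ∃ e ∈ E, x ∈ e)
    (h5 : ∀ (i : ℕ) (h : i < p.edges.length), (p.edges.get ⟨i, h⟩ ∈ E ↔ Even i)) :
    IsAltPath G M p ↔ E ⊆ M := by
  constructor
  · rintro ⟨-, -, h⟩ e he
    obtain ⟨⟨i, hi⟩, rfl⟩ := List.get_of_mem (h2 e he)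
    exact (h i hi).2 ((h5 i hi).1 he)
  · intro h
    refine ⟨hp, ho, fun i hi => ⟨fun hm => ?_, fun he => h ((h5 i hi).2 he)⟩⟩
    rw [← h5 i hi]
    by_contra hn
    have hmem := List.get_mem p.edges ⟨i, hi⟩
    generalize p.edges.get ⟨i, hi⟩ = e at *
    induction e with
    | _ a b =>
      obtain ⟨f, hf, haf⟩ := h3 a (Walk.mem_support_of_mem_edges hmem (by simp))
      exact hM.2 _ hm _ (h hf) (fun h => hn (h ▸ hf)) a ⟨by simp, haf⟩

theorem cnt_alt [Fintype V] {G : SimpleGraph V} {u v : V} (p : G.Walk u v) (hp : p.IsPath)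
    (ho : Odd p.length) (k : ℕ) :
    #{M : Finset (Sym2 V) | (IsMatching G M ∧ #M = k + 1) ∧ IsAltPath G M p} =
      cnt G p.support.toFinset (2 * k + 1) p.length := by
  obtain ⟨n, hn⟩ := ho
  obtain ⟨E, h1, h2, h3, h4, h5⟩ := evens n p hn hp
  have hE : ∀ e ∈ E, ∀ x ∈ e, x ∈ p.support := by
    intro e he x hx
    exact Walk.mem_support_of_mem_edges (h2 e he) hx
  have hd : ∀ M : Finset (Sym2 V), (∀ e ∈ M, ∀ x ∈ p.support.toFinset, x ∉ e) →
      ∀ e ∈ M, ∀ f ∈ E, ∀ x, x ∈ e → x ∉ f := by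
    intro M hM e he f hf x hx hxf
    exact hM e he x (List.mem_toFinset.2 (hE f hf x hxf)) hx
  unfold cnt
  refine Finset.card_bij' (fun M _ => M \ E) (fun M _ => M ∪ E) ?_ ?_ ?_ ?_
  · intro M hM
    simp only [Finset.mem_filter, Finset.mem_univ, true_and] at hM ⊢
    obtain ⟨⟨hM, hk⟩, ha⟩ := hM
    rw [alt_iff p hp ⟨n, hn⟩ hM h2 h3 h5] at ha
    refine ⟨matching_mono hM sdiff_subset, ?_, ?_⟩
    · intro e he x hx hxe
      obtain ⟨f, hf, hxf⟩ := h3 x (List.mem_toFinset.1 hx)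
      rw [mem_sdiff] at he
      exact hM.2 e he.1 f (ha hf) (fun h => he.2 (h ▸ hf)) x ⟨hxe, hxf⟩
    · have := card_sdiff_add_card_eq_card ha
      omega
  · intro M hM
    simp only [Finset.mem_filter, Finset.mem_univ, true_and] at hM ⊢
    obtain ⟨hM, ha, hk⟩ := hM
    have hU := matching_union hM h1 (hd M ha)
    refine ⟨⟨hU, ?_⟩, (alt_iff p hp ⟨n, hn⟩ hU h2 h3 h5).2 subset_union_right⟩
    rw [card_union_of_disjoint (disj_of (hd M ha))]
    omega
  · intro M hM
    simp only [Finset.mem_filter, Finset.mem_univ, true_and] at hM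
    obtain ⟨⟨hM, hk⟩, ha⟩ := hM
    rw [alt_iff p hp ⟨n, hn⟩ hM h2 h3 h5] at ha
    exact sdiff_union_of_subset ha
  · intro M hM
    simp only [Finset.mem_filter, Finset.mem_univ, true_and] at hM
    obtain ⟨hM, ha, hk⟩ := hM
    exact union_sdiff_cancel_right (disj_of (hd M ha))

theorem cnt_zero [Fintype V] {G : SimpleGraph V} {u v : V} (p : G.Walk u v) (hp : p.IsPath)
    (k : ℕ) (hk : ∀ M, IsMatching G M → #M ≤ k) :
    cnt G p.support.toFinset (2 * k + 1) p.length = 0 := by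
  by_cases ho : Odd p.length
  · rw [← cnt_alt p hp ho, Finset.card_eq_zero, Finset.filter_eq_empty_iff]
    rintro M - ⟨⟨h, h'⟩, -⟩
    have := hk M h
    omega
  · unfold cnt
    rw [Finset.card_eq_zero, Finset.filter_eq_empty_iff]
    rintro M - ⟨-, -, h⟩
    rw [Nat.not_odd_iff_even] at ho
    obtain ⟨n, hn⟩ := ho
    omega

noncomputable def pth {G : SimpleGraph V} (hT : G.IsTree) (u v : V) : G.Walk u v :=
  (hT.connected.exists_path_of_dist u v).choose

theorem pth_isPath {G : SimpleGraph V} (hT : G.IsTree) (u v : V) : (pth hT u v).IsPath :=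
  (hT.connected.exists_path_of_dist u v).choose_spec.1

theorem pth_length {G : SimpleGraph V} (hT : G.IsTree) (u v : V) :
    (pth hT u v).length = G.dist u v :=
  (hT.connected.exists_path_of_dist u v).choose_spec.2

theorem pth_eq {G : SimpleGraph V} (hT : G.IsTree) {u v : V} {p : G.Walk u v} (hp : p.IsPath) :
    p = pth hT u v :=
  (hT.existsUnique_path u v).unique hp (pth_isPath hT u v)

noncomputable def P {G : SimpleGraph V} (hT : G.IsTree) (u v : V) : Finset V :=
  (pth hT u v).support.toFinset

theorem P_of {G : SimpleGraph V} (hT : G.IsTree) {u v : V} {p : G.Walk u v} (hp : p.IsPath) :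
    P hT u v = p.support.toFinset ∧ G.dist u v = p.length := by
  rw [P, ← pth_length hT, pth_eq hT hp]
  exact ⟨rfl, rfl⟩

theorem P_cons {G : SimpleGraph V} (hT : G.IsTree) {u v w : V} (h : G.Adj w u) (hw : w ∉ P hT u v) :
    P hT w v = insert w (P hT u v) ∧ G.dist w v = G.dist u v + 1 := by
  have hp : (Walk.cons h (pth hT u v)).IsPath :=
    (pth_isPath hT u v).cons (by simpa [P] using hw)
  obtain ⟨h1, h2⟩ := P_of hT hp
  rw [h1, h2]
  simp [P, pth_length]

theorem P_self {G : SimpleGraph V} (hT : G.IsTree) (u : V) : P hT u u = {u} := by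
  rw [(P_of hT (Walk.IsPath.nil (u := u))).1]; simp

theorem P_symm {G : SimpleGraph V} (hT : G.IsTree) (u v : V) : P hT u v = P hT v u := by
  rw [(P_of hT (pth_isPath hT v u).reverse).1]
  ext x; simp [P]

theorem P_step {G : SimpleGraph V} (hT : G.IsTree) {u v : V} (huv : u ≠ v) :
    ∃ a, G.Adj u a ∧ u ∉ P hT a v ∧ P hT u v = insert u (P hT a v) ∧
      G.dist u v = G.dist a v + 1 ∧ ∀ w, G.Adj u w → (w ∈ P hT a v ↔ w = a) := by
  obtain ⟨p, hp⟩ : ∃ p : G.Walk u v, p.IsPath := ⟨_, pth_isPath hT u v⟩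
  match p, hp with
  | .nil, _ => exact absurd rfl huv
  | .cons (v := a) h q, hp =>
    rw [Walk.cons_isPath_iff] at hp
    have h1 : u ∉ P hT a v := by
      rw [(P_of hT hp.1).1]; simpa using hp.2
    have h2 := P_cons hT h h1
    refine ⟨a, h, h1, h2.1, h2.2, fun w hw => ⟨fun hm => ?_, ?_⟩⟩
    · rw [(P_of hT hp.1).1, List.mem_toFinset] at hm
      have ht := hp.1.takeUntil hm
      have hc : (Walk.cons h (q.takeUntil w hm)).IsPath :=
        ht.cons (fun hu => hp.2 (q.support_takeUntil_subset_support hm hu))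
      have hc' : (Walk.cons hw Walk.nil).IsPath := by
        simp [Walk.cons_isPath_iff, hw.ne]
      have := (P_of hT hc).2.symm.trans (P_of hT hc').2
      simp only [Walk.length_cons, Walk.length_nil] at this
      exact (Walk.eq_of_length_eq_zero (p := q.takeUntil w hm) (by omega)).symm
    · rintro rfl
      rw [(P_of hT hp.1).1, List.mem_toFinset]
      exact q.start_mem_support

noncomputable def N [Fintype V] {G : SimpleGraph V} (hT : G.IsTree) (c : ℕ) (u v : V) : ℕ :=
  cnt G (P hT u v) c (G.dist u v)

theorem N_self [Fintype V] {G : SimpleGraph V} (hT : G.IsTree) (c : ℕ) (u : V) :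
    cnt G ∅ (c + 1) 0 = N hT (c + 1) u u + ∑ w ∈ {w : V | G.Adj u w}, N hT c w u := by
  rw [cnt_rec G ∅ (c + 1) 0 u (by simp)]
  simp only [N, P_self, SimpleGraph.dist_self]
  congr 1
  refine Finset.sum_congr (by simp) fun w hw => ?_
  simp only [Finset.mem_filter, Finset.mem_univ, true_and] at hw
  have := P_cons hT (v := u) hw.symm (by simp [P_self, hw.ne'])
  rw [this.1, this.2, cnt_shift]
  simp only [SimpleGraph.dist_self, P_self]
  rfl

theorem N_step [Fintype V] {G : SimpleGraph V} (hT : G.IsTree) (c : ℕ) {u v : V} (huv : u ≠ v) :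
    ∃ a, G.Adj u a ∧ G.dist u v = G.dist a v + 1 ∧
      (∀ w, G.Adj u w → w ≠ a → G.dist w v = G.dist u v + 1) ∧
      N hT c a v = N hT (c + 1) u v + ∑ w ∈ {w : V | G.Adj u w ∧ w ≠ a}, N hT c w v := by
  obtain ⟨a, ha, h1, h2, h3, h4⟩ := P_step hT huv
  have key : ∀ w, G.Adj u w → w ≠ a → w ∉ P hT u v := by
    intro w hw hwa hm
    rw [h2, Finset.mem_insert, h4 w hw] at hm
    rcases hm with rfl | hm
    · exact hw.ne rfl
    · exact hwa hm
  refine ⟨a, ha, h3, fun w hw hwa => (P_cons hT hw.symm (key w hw hwa)).2, ?_⟩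
  rw [N, cnt_rec G _ _ _ u h1]
  congr 1
  · rw [N, h3, cnt_shift, h2]
  · refine Finset.sum_congr ?_ fun w hw => ?_
    · ext w
      simp only [Finset.mem_filter, Finset.mem_univ, true_and]
      constructor
      · rintro ⟨h, h'⟩
        exact ⟨h, fun e => h' ((h4 w h).2 e)⟩
      · rintro ⟨h, h'⟩
        exact ⟨h, fun e => h' ((h4 w h).1 e)⟩
    · simp only [Finset.mem_filter, Finset.mem_univ, true_and] at hw
      obtain ⟨e1, e2⟩ := P_cons hT hw.1.symm (key w hw.1 hw.2)
      rw [N, e1, e2, h2, h3]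

theorem N_parity [Fintype V] {G : SimpleGraph V} (hT : G.IsTree) {c : ℕ} {u v : V}
    (h : N hT c u v ≠ 0) : c % 2 = G.dist u v % 2 := by
  rw [N, cnt, Finset.card_ne_zero] at h
  obtain ⟨M, hM⟩ := h
  simp only [Finset.mem_filter, Finset.mem_univ, true_and] at hM
  omega

noncomputable def R [Fintype V] {G : SimpleGraph V} (hT : G.IsTree) (c : ℕ) : Matrix V V ℚ :=
  fun u v => (-1) ^ (G.dist u v / 2) * (N hT c u v : ℚ)

theorem R_ne [Fintype V] {G : SimpleGraph V} (hT : G.IsTree) (c : ℕ) {u v : V} (huv : u ≠ v) :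
    ∑ w ∈ {w : V | G.Adj u w}, R hT c w v =
      (-1) ^ ((G.dist u v - 1) / 2) * (N hT (c + 1) u v : ℚ) := by
  obtain ⟨a, h1, h2, h3, h4⟩ := N_step hT c huv
  have hs : ({w : V | G.Adj u w} : Finset V) = insert a ({w : V | G.Adj u w ∧ w ≠ a} : Finset V) := by
    ext w
    simp only [Finset.mem_filter, Finset.mem_univ, true_and, Finset.mem_insert]
    by_cases hw : w = a
    · simp [hw, h1]
    · simp [hw]
  rw [hs, Finset.sum_insert (by simp)]
  have : ∑ w ∈ {w : V | G.Adj u w ∧ w ≠ a}, R hT c w v =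
      - ((-1) ^ ((G.dist u v - 1) / 2) * ((∑ w ∈ {w : V | G.Adj u w ∧ w ≠ a}, N hT c w v : ℕ) : ℚ)) := by
    push_cast
    rw [Finset.mul_sum, ← Finset.sum_neg_distrib]
    refine Finset.sum_congr rfl fun w hw => ?_
    simp only [Finset.mem_filter, Finset.mem_univ, true_and] at hw
    have e : G.dist w v / 2 = (G.dist u v - 1) / 2 + 1 := by
      rw [h3 w hw.1 hw.2, h2]; omega
    rw [R, e, pow_succ]
    ring
  rw [this, R, h4, h2]
  push_cast
  ring

theorem R_odd [Fintype V] {G : SimpleGraph V} (hT : G.IsTree) (c : ℕ) (hc : Even c) (u v : V) :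
    ∑ w ∈ {w : V | G.Adj u w}, R hT c w v = R hT (c + 1) u v := by
  obtain ⟨k, hk⟩ := hc
  by_cases huv : u = v
  · subst huv
    have h0 : N hT (c + 1) u u = 0 := by
      by_contra h
      have := N_parity hT h
      simp at this
      omega
    rw [R, h0]
    simp only [Nat.cast_zero, mul_zero]
    refine Finset.sum_eq_zero fun w hw => ?_
    simp only [Finset.mem_filter, Finset.mem_univ, true_and] at hw
    have h0 : N hT c w u = 0 := by
      by_contra h
      have := N_parity hT h
      rw [SimpleGraph.dist_eq_one_iff_adj.2 hw.symm] at this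
      omega
    rw [R, h0]; simp
  · rw [R_ne hT c huv, R]
    by_cases h : N hT (c + 1) u v = 0
    · simp [h]
    · have := N_parity hT h
      congr 2
      omega

theorem R_even [Fintype V] {G : SimpleGraph V} (hT : G.IsTree) (c : ℕ) (hc : Odd c) (u v : V) :
    ∑ w ∈ {w : V | G.Adj u w}, R hT c w v =
      (if u = v then (cnt G ∅ (c + 1) 0 : ℚ) else 0) - R hT (c + 1) u v := by
  obtain ⟨k, hk⟩ := hc
  by_cases huv : u = v
  · subst huv
    rw [if_pos rfl, N_self hT c u, R]
    push_cast
    simp only [SimpleGraph.dist_self, Nat.zero_div, pow_zero, one_mul, add_sub_cancel_left]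
    refine Finset.sum_congr rfl fun w hw => ?_
    simp only [Finset.mem_filter, Finset.mem_univ, true_and] at hw
    rw [R, SimpleGraph.dist_eq_one_iff_adj.2 hw.symm]
    simp
  · rw [R_ne hT c huv, R, if_neg huv]
    by_cases h : N hT (c + 1) u v = 0
    · simp [h]
    · have := N_parity hT h
      have hpos : 0 < G.dist u v := hT.connected.pos_dist_of_ne huv
      have e : G.dist u v / 2 = (G.dist u v - 1) / 2 + 1 := by omega
      rw [e, pow_succ]
      ring

theorem R_symm [Fintype V] {G : SimpleGraph V} (hT : G.IsTree) (c : ℕ) (u v : V) :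
    R hT c u v = R hT c v u := by
  simp only [R, N, P_symm hT u v, SimpleGraph.dist_comm (u := u) (v := v)]

theorem mu_eq [Fintype V] {G : SimpleGraph V} (hT : G.IsTree) (k : ℕ)
    (hmax : ∀ M, IsMaximumMatching G M ↔ (IsMatching G M ∧ #M = k + 1)) (u v : V) :
    (muT G u v : ℚ) = R hT (2 * k + 1) u v := by
  have hset : {M : Finset (Sym2 V) | IsMaximumMatching G M ∧ HasAltPath G M u v} =
      ((({M : Finset (Sym2 V) | (IsMatching G M ∧ #M = k + 1) ∧ IsAltPath G M (pth hT u v)}) :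
        Finset (Finset (Sym2 V))) : Set (Finset (Sym2 V))) := by
    ext M
    simp only [Set.mem_ofPred_eq, Finset.coe_filter, Finset.mem_univ, true_and, hmax]
    refine and_congr_right fun _ => ⟨?_, fun h => ⟨_, h⟩⟩
    rintro ⟨p, hp⟩
    rw [← pth_eq hT hp.1]
    exact hp
  rw [muT, hset, Set.ncard_coe_finset, R, N]
  by_cases ho : Odd (pth hT u v).length
  · rw [cnt_alt _ (pth_isPath hT u v) ho, pth_length, P]
    rw [pth_length] at ho
    push_cast
    congr 1
    obtain ⟨n, hn⟩ := ho
    rw [hn]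
    have e : (2 * n + 1) / 2 = n := by omega
    rw [e]
    rcases Nat.even_or_odd n with h | h
    · rw [h.neg_one_pow, if_pos]
      obtain ⟨j, hj⟩ := h
      omega
    · rw [h.neg_one_pow, if_neg]
      obtain ⟨j, hj⟩ := h
      omega
  · have h1 : #{M : Finset (Sym2 V) | (IsMatching G M ∧ #M = k + 1) ∧ IsAltPath G M (pth hT u v)} = 0 := by
      rw [Finset.card_eq_zero, Finset.filter_eq_empty_iff]
      rintro M - ⟨-, h⟩
      exact ho h.2.1
    have h2 : cnt G (P hT u v) (2 * k + 1) (G.dist u v) = 0 := by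
      by_contra h
      have := N_parity hT h
      rw [pth_length, Nat.not_odd_iff] at ho
      omega
    rw [h1, h2]
    simp

theorem exists_max [Fintype V] {G : SimpleGraph V} (hT : G.IsTree) (hV : 2 ≤ Fintype.card V) :
    ∃ k, (∀ M, IsMaximumMatching G M ↔ (IsMatching G M ∧ #M = k + 1)) ∧
      (∀ M, IsMatching G M → #M ≤ k + 1) ∧ cnt G ∅ (2 * k + 2) 0 ≠ 0 := by
  obtain ⟨u, v, huv⟩ := Fintype.exists_pair_of_one_lt_card hV
  obtain ⟨a, ha, -⟩ := P_step hT huv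
  have hne : ({M : Finset (Sym2 V) | IsMatching G M} : Finset _).Nonempty :=
    ⟨{s(u, a)}, by simpa using matching_single ha⟩
  obtain ⟨M, hM, hmax⟩ := Finset.exists_max_image _ (fun M : Finset (Sym2 V) => #M) hne
  simp only [Finset.mem_filter, Finset.mem_univ, true_and] at hM hmax
  have h1 := hmax _ (matching_single ha)
  rw [card_singleton] at h1
  obtain ⟨k, hk⟩ : ∃ k, #M = k + 1 := ⟨#M - 1, by omega⟩
  refine ⟨k, fun M' => ⟨fun h => ⟨h.1, le_antisymm (hk ▸ hmax _ h.1) (hk ▸ h.2 _ hM)⟩, fun h =>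
    ⟨h.1, fun M'' h'' => ?_⟩⟩, fun M' h => hk ▸ hmax _ h, ?_⟩
  · rw [h.2, ← hk]; exact hmax _ h''
  · rw [cnt, Finset.card_ne_zero]
    refine ⟨M, ?_⟩
    simp only [Finset.mem_filter, Finset.mem_univ, true_and]
    exact ⟨hM, by simp, by omega⟩

theorem span_le_of_mul [Fintype V] (A X C : Matrix V V ℚ) (h : A = X * C) :
    Submodule.span ℚ (Set.range fun u => A u) ≤ Submodule.span ℚ (Set.range fun u => C u) := by
  rw [Submodule.span_le]
  rintro _ ⟨u, rfl⟩
  have : A u = ∑ w, X u w • C w := by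
    ext v
    simp [h, Matrix.mul_apply, Finset.sum_apply]
  simp only [this]
  exact Submodule.sum_mem _ fun w _ => Submodule.smul_mem _ _ (Submodule.subset_span ⟨w, rfl⟩)

theorem main [Fintype V] (G : SimpleGraph V) (hT : G.IsTree) (hV : 2 ≤ Fintype.card V)
    (A C : Matrix V V ℚ)
    (hA : ∀ u v : V, A u v = if G.Adj u v then 1 else 0)
    (hC : ∀ u v : V, C u v = (muT G u v : ℚ)) :
    Submodule.span ℚ (Set.range fun u => A u) = Submodule.span ℚ (Set.range fun u => C u) := by
  obtain ⟨k, hmax, hle, hm⟩ := exists_max hT hV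
  have hCR : C = R hT (2 * k + 1) := by
    ext u v
    rw [hC, mu_eq hT k hmax]
  have hmul : ∀ (B : Matrix V V ℚ) u v, (A * B) u v = ∑ w ∈ {w : V | G.Adj u w}, B w v := by
    intro B u v
    simp [Matrix.mul_apply, hA, Finset.sum_filter]
  have hAt : A.transpose = A := by
    ext u v
    simp [hA, SimpleGraph.adj_comm]
  have hRt : ∀ c, (R hT c).transpose = R hT c := by
    intro c
    ext u v
    simp [R_symm hT c u v]
  have e1 : A * R hT (2 * k) = C := by
    ext u v
    rw [hmul, R_odd hT _ (by simp), hCR]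
  have e2 : A * C = (cnt G ∅ (2 * k + 2) 0 : ℚ) • (1 : Matrix V V ℚ) - R hT (2 * k + 2) := by
    ext u v
    rw [hmul, hCR, R_even hT _ ⟨k, rfl⟩]
    simp [Matrix.one_apply]
  have e3 : A * R hT (2 * k + 2) = 0 := by
    ext u v
    rw [hmul, R_odd hT _ ⟨k + 1, by ring⟩, R, N]
    have := cnt_zero (pth hT u v) (pth_isPath hT u v) (k + 1) hle
    rw [pth_length] at this
    rw [P, show 2 * k + 2 + 1 = 2 * (k + 1) + 1 by ring, this]
    simp
  have hm' : (cnt G ∅ (2 * k + 2) 0 : ℚ) ≠ 0 := by exact_mod_cast hm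
  apply le_antisymm
  · apply span_le_of_mul _ ((cnt G ∅ (2 * k + 2) 0 : ℚ)⁻¹ • (A * A))
    rw [Matrix.smul_mul, Matrix.mul_assoc, e2, Matrix.mul_sub, e3, sub_zero, Matrix.mul_smul,
      Matrix.mul_one, smul_smul, inv_mul_cancel₀ hm', one_smul]
  · apply span_le_of_mul _ (R hT (2 * k))
    rw [← hRt (2 * k), ← hAt, ← Matrix.transpose_mul, e1, hCR, hRt]
end S9

/-- Let `A` be the adjacency matrix of a tree `T` (as a rational matrix) and
let `C` be the matrix with entries `C_{uv} = μ_T(u,v)`. Then `A` and `C` have the same row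
space over `ℚ`. -/
theorem stmt9 {V : Type*} [Fintype V] [DecidableEq V] (G : SimpleGraph V)
    [DecidableRel G.Adj] (hT : G.IsTree) (hV : 2 ≤ Fintype.card V)
    (A C : Matrix V V ℚ)
    (hA : ∀ u v : V, A u v = if G.Adj u v then 1 else 0)
    (hC : ∀ u v : V, C u v = (muT G u v : ℚ)) :
    Submodule.span ℚ (Set.range fun u => A u) = Submodule.span ℚ (Set.range fun u => C u) := by
  exact S9.main G hT hV A C (fun u v => by rw [hA]; congr) hC
end

section
/- Let u be a saturated vertex of a tree T and let w ≠ u be a vertex at even (positive) distance from u. Let y be the neighbour of w on the unique u–w path in T and let Q be the u–y subpath of that path. Then every maximum matching M of T that turns Q into a matched path (i.e., for which Q is a u_M y alternating path) covers w. -/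
/-! Basic definitions: matchings of a simple graph (as finite sets of edges),
maximum matchings, the number `m(T)` of maximum matchings, alternating paths,
the quantity `μ_T(u,v)`, and generalized inverses of real symmetric matrices. -/

variable {V : Type*}

theorem aux_flip {V : Type*} [DecidableEq V] (G : SimpleGraph V) {u : V} (n : ℕ) :
    ∀ (w : V) (P : G.Walk w u) (M : Finset (Sym2 V)), P.length = 2 * n → P.IsPath →
      (∀ (i : ℕ) (h : i < P.edges.length), Odd i → P.edges[i] ∈ M) →
      IsMaximumMatching G M → ¬ Covers M w → ¬ Saturated G u := by
  induction n with
  | zero =>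
    intro w P M hl _ _ hM hw hS
    cases P with
    | nil => exact hw (hS M hM)
    | cons h p => simp at hl
  | succ n ih =>
    intro w P M hl hP hodd hM hw
    cases P with
    | nil => simp at hl
    | @cons _ y _ hwy p =>
      cases p with
      | nil => simp at hl; omega
      | @cons _ x _ hyx p =>
        have hxy : s(y, x) ∈ M := by
          have := hodd 1 (by simp) (by decide)
          simpa using this
        have hP1 := hP
        simp only [SimpleGraph.Walk.cons_isPath_iff, SimpleGraph.Walk.support_cons,
          List.mem_cons, not_or] at hP
        obtain ⟨⟨hp, hyp⟩, hwy', hwp⟩ := hP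
        have hxp : x ∈ p.support := p.start_mem_support
        have hxw : x ≠ w := fun h => hwp (h ▸ hxp)
        have hxy' : x ≠ y := fun h => hyp (h ▸ hxp)
        have hwyM : s(w, y) ∉ M := fun h => hw ⟨_, h, by simp⟩
        obtain ⟨⟨hE, hD⟩, hmax⟩ := hM
        have hcard : (insert s(w, y) (M.erase s(y, x))).card = M.card := by
          rw [Finset.card_insert_of_notMem (by simp [hwyM]), Finset.card_erase_of_mem hxy]
          have := Finset.card_pos.mpr ⟨_, hxy⟩
          omega
        have key : ∀ f ∈ M, f ≠ s(y, x) → ∀ v, v ∈ s(w, y) → v ∉ f := by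
          intro f hf hne v hv hvf
          rcases Sym2.mem_iff.mp hv with rfl | rfl
          · exact hw ⟨f, hf, hvf⟩
          · exact hD f hf _ hxy hne v ⟨hvf, by simp⟩
        refine ih x p (insert s(w, y) (M.erase s(y, x))) ?_ hp ?_ ⟨⟨?_, ?_⟩, ?_⟩ ?_
        · simp at hl; omega
        · intro i h hi
          have h2 := hodd (i + 2) (by simpa using h) (by simpa [parity_simps] using hi)
          simp only [SimpleGraph.Walk.edges_cons, List.getElem_cons_succ] at h2
          refine Finset.mem_insert_of_mem (Finset.mem_erase.mpr ⟨?_, h2⟩)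
          intro h3
          have h4 : s(y, x) ∈ p.edges := h3 ▸ List.getElem_mem h
          exact hyp (p.fst_mem_support_of_mem_edges h4)
        · intro e he
          rcases Finset.mem_insert.mp he with rfl | he
          · exact hwy
          · exact hE e (Finset.mem_of_mem_erase he)
        · intro e he f hf hne v ⟨hve, hvf⟩
          rcases Finset.mem_insert.mp he with rfl | he <;>
            rcases Finset.mem_insert.mp hf with rfl | hf
          · exact hne rfl
          · exact key f (Finset.mem_of_mem_erase hf) (Finset.ne_of_mem_erase hf) v hve hvf
          · exact key e (Finset.mem_of_mem_erase he) (Finset.ne_of_mem_erase he) v hvf hve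
          · exact hD e (Finset.mem_of_mem_erase he) f (Finset.mem_of_mem_erase hf) hne v ⟨hve, hvf⟩
        · intro M' hM'
          rw [hcard]
          exact hmax M' hM'
        · rintro ⟨e, he, hxe⟩
          rcases Finset.mem_insert.mp he with rfl | he
          · simp [hxw, hxy'] at hxe
          · exact hD e (Finset.mem_of_mem_erase he) _ hxy (Finset.ne_of_mem_erase he) x
              ⟨hxe, by simp⟩

/-- Let `u` be a saturated vertex of a tree `T` and `w ≠ u` a vertex at even
positive distance from `u`. Let `y` be the neighbour of `w` on the unique `u–w` path and `Q`
the `u–y` subpath (so that `Q` followed by the edge `yw` is the `u–w` path). Then every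
maximum matching `M` of `T` that turns `Q` into a matched path (i.e. `Q` is a `u_M y`
alternating path) covers `w`. -/
theorem stmt11 {V : Type*} [Fintype V] [DecidableEq V] (G : SimpleGraph V)
    [DecidableRel G.Adj] (hT : G.IsTree) (hV : 2 ≤ Fintype.card V)
    (u w : V) (hwu : w ≠ u) (heven : Even (G.dist u w)) (hpos : 0 < G.dist u w)
    (hu : Saturated G u)
    (y : V) (Q : G.Walk u y) (hyw : G.Adj y w) (hP : (Q.concat hyw).IsPath)
    (M : Finset (Sym2 V)) (hM : IsMaximumMatching G M) (hQ : IsAltPath G M Q) :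
    Covers M w := by
  by_contra hw
  obtain ⟨_, ⟨k, hk⟩, halt⟩ := hQ
  refine aux_flip G (k + 1) w (Q.concat hyw).reverse M ?_ hP.reverse ?_ hM hw hu
  · simp [hk]; omega
  · intro i h hi
    obtain ⟨j, rfl⟩ := hi
    have hlen : Q.edges.length = 2 * k + 1 := by simp [hk]
    have h' : 2 * j < Q.edges.length := by
      simp at h
      omega
    have hh := (halt (Q.edges.length - 1 - 2 * j) (by omega)).mpr ⟨k - j, by omega⟩
    have he : (Q.concat hyw).reverse.edges = s(y, w) :: Q.edges.reverse := by
      simp [SimpleGraph.Walk.edges_concat]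
    simp only [he, List.getElem_cons_succ, List.getElem_reverse]
    exact hh
end
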